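/- Let (R,𝔪) be a Cohen-Macaulay local ring with canonical module that is generically Gorenstein, let ω be a canonical ideal of R, and let x ∈ ω be an R-regular element. Then exactly one of the following holds: (1) X_{ω/ω²} ≅ X^{ω²/xω} ≅ X^{ω²}; (2) X_{ω/ω²} ≅ ω ⊕ X^{ω²/xω} ≅ X^{ω²}; (3) X_{ω/ω²} ≅ ω ⊕ X^{ω²/xω} ≅ ω ⊕ X^{ω²}. Here X_M denotes the MCM part of the minimal MCM approximation of M and X^M the MCM part of the minimal FID hull of M. -/

import Mathlib

open CategoryTheory

noncomputable section

/-- The Ext module `Ext^n_R(M, N)` for `R`-modules `M`, `N`. -/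
abbrev ModExt (R : Type) [CommRing R] (n : ℕ) (M N : ModuleCat R) : ModuleCat R :=
  ((Ext R (ModuleCat R) n).obj (Opposite.op M)).obj N

/-- An `R`-module `M` has finite injective dimension if `Ext^i_R(-, M)` vanishes
for all `i` beyond some bound. -/
def HasFiniteInjDim (R : Type) [CommRing R] (M : ModuleCat R) : Prop :=
  ∃ n : ℕ, ∀ (N : ModuleCat R) (i : ℕ), n < i → Subsingleton (ModExt R i N M)

/-- The depth of a module over a local ring, via Rees' characterization:
the least `n` with `Ext^n(k, M) ≠ 0`. -/
def moduleDepth (R : Type) [CommRing R] [IsLocalRing R] (M : ModuleCat R) : ℕ∞ :=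
  sInf {n : ℕ∞ | ∃ m : ℕ, n = (m : ℕ∞) ∧
    Nontrivial (ModExt R m (ModuleCat.of R (IsLocalRing.ResidueField R)) M)}

/-- A Noetherian local ring is Cohen-Macaulay if its depth equals its Krull dimension. -/
def IsCMLocalRing (R : Type) [CommRing R] [IsLocalRing R] : Prop :=
  IsNoetherianRing R ∧
    (moduleDepth R (ModuleCat.of R R) : WithBot ℕ∞) = ringKrullDim R

/-- A maximal Cohen-Macaulay module: finitely generated with depth equal to `dim R`. -/
def IsMCM (R : Type) [CommRing R] [IsLocalRing R] (X : ModuleCat R) : Prop :=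
  Module.Finite R X ∧ (moduleDepth R X : WithBot ℕ∞) = ringKrullDim R

/-- A Cohen-Macaulay module of codimension one:
`depth M = dim M = dim R - 1`. -/
def IsCMofCodimOne (R : Type) [CommRing R] [IsLocalRing R] (M : ModuleCat R) : Prop :=
  Module.Finite R M ∧ ∃ d : ℕ, ringKrullDim R = ((d + 1 : ℕ) : WithBot ℕ∞) ∧
    moduleDepth R M = (d : ℕ∞) ∧
    ringKrullDim (R ⧸ Module.annihilator R M) = ((d : ℕ) : WithBot ℕ∞)

/-- A Gorenstein local ring: Noetherian local with finite injective dimension over itself. -/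
def IsGorensteinLocalRing (A : Type) [CommRing A] : Prop :=
  IsNoetherianRing A ∧ IsLocalRing A ∧ HasFiniteInjDim A (ModuleCat.of A A)

/-- `R` is generically Gorenstein if its localization at every minimal prime is Gorenstein. -/
def IsGenericallyGorenstein (R : Type) [CommRing R] : Prop :=
  ∀ p ∈ minimalPrimes R, ∀ h : p.IsPrime,
    letI := h
    IsGorensteinLocalRing (Localization.AtPrime p)

/-- A canonical module of a local ring `R`: finitely generated, of finite injective
dimension, with `Ext^i(k, ω) ≅ k` for `i = dim R` and `Ext^i(k, ω) = 0` otherwise. -/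
def IsCanonicalModule (R : Type) [CommRing R] [IsLocalRing R] (W : ModuleCat R) : Prop :=
  Module.Finite R W ∧ HasFiniteInjDim R W ∧
    ∃ d : ℕ, ringKrullDim R = (d : ℕ) ∧
      Nonempty ((ModExt R d (ModuleCat.of R (IsLocalRing.ResidueField R)) W) ≃ₗ[R]
        IsLocalRing.ResidueField R) ∧
      ∀ i : ℕ, i ≠ d →
        Subsingleton (ModExt R i (ModuleCat.of R (IsLocalRing.ResidueField R)) W)

/-- A canonical ideal: an ideal of `R` which, as an `R`-module, is a canonical module. -/
def IsCanonicalIdeal (R : Type) [CommRing R] [IsLocalRing R] (I : Ideal R) : Prop :=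
  IsCanonicalModule R (ModuleCat.of R I)

/-- `Y` and `X` have a common nonzero direct summand via the map `ι : Y → X`. -/
def HasCommonSummandVia (R : Type) [CommRing R] {Y X : ModuleCat R}
    (ι : Y →ₗ[R] X) : Prop :=
  ∃ (N Y' X' : ModuleCat.{0} R), Nontrivial N ∧
    ∃ (e : Y ≃ₗ[R] N × Y') (f : X ≃ₗ[R] N × X') (ι' : Y' →ₗ[R] X'),
      ∀ y : Y, f (ι y) = ((e y).1, ι' (e y).2)

/-- `0 → Y → X → M → 0` is an MCM approximation of `M`. -/
def IsMCMApprox (R : Type) [CommRing R] [IsLocalRing R] (M Y X : ModuleCat R)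
    (ι : Y →ₗ[R] X) (π : X →ₗ[R] M) : Prop :=
  Module.Finite R M ∧ Module.Finite R Y ∧ IsMCM R X ∧ HasFiniteInjDim R Y ∧
    Function.Injective ι ∧ Function.Surjective π ∧ Function.Exact ι π

/-- `0 → Y → X → M → 0` is a minimal MCM approximation of `M`. -/
def IsMinMCMApprox (R : Type) [CommRing R] [IsLocalRing R] (M Y X : ModuleCat R)
    (ι : Y →ₗ[R] X) (π : X →ₗ[R] M) : Prop :=
  IsMCMApprox R M Y X ι π ∧ ¬ HasCommonSummandVia R ι

/-- `0 → M → Y → X → 0` is an FID hull of `M`. -/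
def IsFIDHull (R : Type) [CommRing R] [IsLocalRing R] (M Y X : ModuleCat R)
    (ι : M →ₗ[R] Y) (π : Y →ₗ[R] X) : Prop :=
  Module.Finite R M ∧ Module.Finite R Y ∧ HasFiniteInjDim R Y ∧
    (IsMCM R X ∨ Subsingleton X) ∧
    Function.Injective ι ∧ Function.Surjective π ∧ Function.Exact ι π

/-- `0 → M → Y → X → 0` is a minimal FID hull of `M`. -/
def IsMinFIDHull (R : Type) [CommRing R] [IsLocalRing R] (M Y X : ModuleCat R)
    (ι : M →ₗ[R] Y) (π : Y →ₗ[R] X) : Prop :=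
  IsFIDHull R M Y X ι π ∧ ¬ HasCommonSummandVia R π

/-- The free rank of a module: the largest `m` with `R^m` a direct summand. -/
def freeRank (R : Type) [CommRing R] (X : ModuleCat R) : ℕ∞ :=
  sSup {n : ℕ∞ | ∃ m : ℕ, n = (m : ℕ∞) ∧
    ∃ X' : ModuleCat.{0} R, Nonempty (X ≃ₗ[R] ((Fin m → R) × X'))}

/-- The `W`-rank of a module: the largest `m` with `W^m` a direct summand. -/
def wRank (R : Type) [CommRing R] (W X : ModuleCat R) : ℕ∞ :=
  sSup {n : ℕ∞ | ∃ m : ℕ, n = (m : ℕ∞) ∧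
    ∃ X' : ModuleCat.{0} R, Nonempty (X ≃ₗ[R] ((Fin m → W) × X'))}

/-- `M` and `N` are `W`-stably isomorphic. -/
def WStablyIso (R : Type) [CommRing R] (W M N : ModuleCat R) : Prop :=
  ∃ s t : ℕ, Nonempty ((M × (Fin s → W)) ≃ₗ[R] (N × (Fin t → W)))

/-- The quotient module `I/J` (realized as `I` modulo the elements of `J` lying in `I`). -/
abbrev qmod (R : Type) [CommRing R] (I J : Ideal R) : ModuleCat R :=
  ModuleCat.of R (I ⧸ (Submodule.comap I.subtype J))

section ExtToolkit

variable {R : Type} [CommRing R]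
  {A B C M N P : Type} [AddCommGroup A] [Module R A] [AddCommGroup B] [Module R B]
  [AddCommGroup C] [Module R C] [AddCommGroup M] [Module R M] [AddCommGroup N] [Module R N]
  [AddCommGroup P] [Module R P]

/-- `Ext` of unbundled modules, computed in the derived category. -/
abbrev EM (R : Type) [CommRing R] (M N : Type) [AddCommGroup M] [Module R M]
    [AddCommGroup N] [Module R N] (i : ℕ) : Type :=
  Abelian.Ext (ModuleCat.of R M) (ModuleCat.of R N) i

/-- Contravariant functoriality of `EM`. -/
def extPre (f : A →ₗ[R] B) (N : Type) [AddCommGroup N] [Module R N] (i : ℕ) :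
    EM R B N i →ₗ[R] EM R A N i :=
  (Abelian.Ext.mk₀ (ModuleCat.ofHom f)).precompOfLinear R _ (zero_add i)

/-- Covariant functoriality of `EM`. -/
def extPost (A : Type) [AddCommGroup A] [Module R A] (f : M →ₗ[R] N) (i : ℕ) :
    EM R A M i →ₗ[R] EM R A N i :=
  (Abelian.Ext.mk₀ (ModuleCat.ofHom f)).postcompOfLinear R _ (add_zero i)

lemma extPre_apply (f : A →ₗ[R] B) (i : ℕ) (x : EM R B N i) :
    extPre f N i x = (Abelian.Ext.mk₀ (ModuleCat.ofHom f)).comp x (zero_add i) := rfl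

lemma extPost_apply (f : M →ₗ[R] N) (i : ℕ) (x : EM R A M i) :
    extPost A f i x = x.comp (Abelian.Ext.mk₀ (ModuleCat.ofHom f)) (add_zero i) := rfl

lemma extPost_id (i : ℕ) (x : EM R A M i) : extPost A (LinearMap.id : M →ₗ[R] M) i x = x := by
  rw [extPost_apply]
  exact Abelian.Ext.comp_mk₀_id x

lemma extPre_id (i : ℕ) (x : EM R A M i) : extPre (LinearMap.id : A →ₗ[R] A) M i x = x := by
  rw [extPre_apply]
  exact Abelian.Ext.mk₀_id_comp x

lemma extPost_comp (f : M →ₗ[R] N) (g : N →ₗ[R] P) (i : ℕ) (x : EM R A M i) :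
    extPost A (g ∘ₗ f) i x = extPost A g i (extPost A f i x) := by
  simp only [extPost_apply, ModuleCat.ofHom_comp, ← Abelian.Ext.mk₀_comp_mk₀]
  rw [Abelian.Ext.comp_assoc]
  lia

lemma extPre_comp (f : A →ₗ[R] B) (g : B →ₗ[R] C) (i : ℕ) (x : EM R C M i) :
    extPre (g ∘ₗ f) M i x = extPre f M i (extPre g M i x) := by
  simp only [extPre_apply, ModuleCat.ofHom_comp, ← Abelian.Ext.mk₀_comp_mk₀]
  rw [Abelian.Ext.comp_assoc]
  lia

lemma extPost_add (f g : M →ₗ[R] N) (i : ℕ) (x : EM R A M i) :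
    extPost A (f + g) i x = extPost A f i x + extPost A g i x := by
  simp only [extPost_apply, ModuleCat.ofHom_add, Abelian.Ext.mk₀_add, Abelian.Ext.comp_add]

/-- The map `extPost`, additive in the map. -/
def extPostHom (A M N : Type) [AddCommGroup A] [Module R A] [AddCommGroup M] [Module R M]
    [AddCommGroup N] [Module R N] (i : ℕ) (x : EM R A M i) : (M →ₗ[R] N) →+ EM R A N i :=
  AddMonoidHom.mk' (fun f => extPost A f i x) (fun f g => extPost_add f g i x)

lemma extPost_sub (f g : M →ₗ[R] N) (i : ℕ) (x : EM R A M i) :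
    extPost A (f - g) i x = extPost A f i x - extPost A g i x :=
  map_sub (extPostHom A M N i x) f g

lemma extPost_sum {ι : Type} (s : Finset ι) (f : ι → M →ₗ[R] N) (i : ℕ) (x : EM R A M i) :
    extPost A (∑ j ∈ s, f j) i x = ∑ j ∈ s, extPost A (f j) i x :=
  map_sum (extPostHom A M N i x) f s

lemma extPost_zero (i : ℕ) (x : EM R A M i) : extPost A (0 : M →ₗ[R] N) i x = 0 :=
  map_zero (extPostHom A M N i x)

lemma extPre_smul_id (r : R) (i : ℕ) (x : EM R A M i) :
    extPre (r • (LinearMap.id : A →ₗ[R] A)) M i x = r • x := by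
  rw [extPre_apply]
  have : ModuleCat.ofHom (r • (LinearMap.id : A →ₗ[R] A)) = r • 𝟙 (ModuleCat.of R A) := rfl
  rw [this, Abelian.Ext.mk₀_smul, Abelian.Ext.smul_comp]
  rw [Abelian.Ext.mk₀_id_comp]

lemma extPost_smul_id (r : R) (i : ℕ) (x : EM R A M i) :
    extPost A (r • (LinearMap.id : M →ₗ[R] M)) i x = r • x := by
  rw [extPost_apply]
  have : ModuleCat.ofHom (r • (LinearMap.id : M →ₗ[R] M)) = r • 𝟙 (ModuleCat.of R M) := rfl
  rw [this, Abelian.Ext.mk₀_smul, Abelian.Ext.comp_smul]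
  rw [Abelian.Ext.comp_mk₀_id]

lemma extPre_extPost (f : A →ₗ[R] B) (g : M →ₗ[R] N) (i : ℕ) (x : EM R B M i) :
    extPre f N i (extPost B g i x) = extPost A g i (extPre f M i x) := by
  simp only [extPre_apply, extPost_apply]
  rw [Abelian.Ext.comp_assoc]
  lia

/-- A short exact sequence of unbundled modules. -/
structure SES (f : A →ₗ[R] B) (g : B →ₗ[R] C) : Prop where
  inj : Function.Injective f
  surj : Function.Surjective g
  exact : Function.Exact f g

namespace SES

variable {f : A →ₗ[R] B} {g : B →ₗ[R] C}

lemma comp_zero (h : SES f g) : g ∘ₗ f = 0 := LinearMap.ext fun x => (h.exact (f x)).2 ⟨x, rfl⟩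

lemma apply_apply (h : SES f g) (x : A) : g (f x) = 0 := (h.exact (f x)).2 ⟨x, rfl⟩

lemma shortExact (h : SES f g) :
    (ModuleCat.shortComplexOfCompEqZero f g h.comp_zero).ShortExact where
  exact := (ShortComplex.ShortExact.moduleCat_exact_iff_function_exact _).mpr h.exact
  mono_f := (ModuleCat.mono_iff_injective _).mpr h.inj
  epi_g := (ModuleCat.epi_iff_surjective _).mpr h.surj

/-- The contravariant connecting map. -/
def del (h : SES f g) (N : Type) [AddCommGroup N] [Module R N] (i : ℕ) :
    EM R A N i →ₗ[R] EM R C N (i + 1) :=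
  h.shortExact.extClass.precompOfLinear R (ModuleCat.of R N) (add_comm 1 i)

/-- The covariant connecting map. -/
def codel (h : SES f g) (N : Type) [AddCommGroup N] [Module R N] (i : ℕ) :
    EM R N C i →ₗ[R] EM R N A (i + 1) :=
  h.shortExact.extClass.postcompOfLinear R (ModuleCat.of R N) rfl

lemma del_extPost (h : SES f g) (φ : M →ₗ[R] N) (i : ℕ) (x : EM R A M i) :
    h.del N i (extPost A φ i x) = extPost C φ (i + 1) (h.del M i x) := by
  simp only [extPost_apply]
  exact (Abelian.Ext.comp_assoc _ _ _ (add_comm 1 i) _ (by lia)).symm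

lemma pre_exact₁ (h : SES f g) (i : ℕ) {x : EM R A N i} (hx : h.del N i x = 0) :
    ∃ y : EM R B N i, extPre f N i y = x :=
  Abelian.Ext.contravariant_sequence_exact₁ h.shortExact _ x (add_comm 1 i) hx

lemma pre_exact₂ (h : SES f g) (i : ℕ) {x : EM R B N i} (hx : extPre f N i x = 0) :
    ∃ y : EM R C N i, extPre g N i y = x :=
  Abelian.Ext.contravariant_sequence_exact₂ h.shortExact _ x hx

lemma pre_exact₃ (h : SES f g) (i : ℕ) {x : EM R C N (i + 1)} (hx : extPre g N (i + 1) x = 0) :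
    ∃ y : EM R A N i, h.del N i y = x :=
  Abelian.Ext.contravariant_sequence_exact₃ h.shortExact _ x hx (add_comm 1 i)

lemma del_pre (h : SES f g) (i : ℕ) (x : EM R B N i) : h.del N i (extPre f N i x) = 0 :=
  ShortComplex.ShortExact.extClass_comp_assoc h.shortExact x (h := add_comm 1 i)

lemma pre_del (h : SES f g) (i : ℕ) (x : EM R A N i) : extPre g N (i + 1) (h.del N i x) = 0 :=
  ShortComplex.ShortExact.comp_extClass_assoc h.shortExact x (add_comm 1 i)

lemma post_exact₁ (h : SES f g) (i : ℕ) {x : EM R N A (i + 1)} (hx : extPost N f (i + 1) x = 0) :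
    ∃ y : EM R N C i, h.codel N i y = x :=
  Abelian.Ext.covariant_sequence_exact₁ _ h.shortExact x hx rfl

lemma post_exact₂ (h : SES f g) (i : ℕ) {x : EM R N B i} (hx : extPost N g i x = 0) :
    ∃ y : EM R N A i, extPost N f i y = x :=
  Abelian.Ext.covariant_sequence_exact₂ _ h.shortExact x hx

lemma post_exact₃ (h : SES f g) (i : ℕ) {x : EM R N C i} (hx : h.codel N i x = 0) :
    ∃ y : EM R N B i, extPost N g i y = x :=
  Abelian.Ext.covariant_sequence_exact₃ _ h.shortExact x rfl hx

end SES

/-- Vanishing of `Ext^i(M, N)`. -/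
def ExtV (R : Type) [CommRing R] (M N : Type) [AddCommGroup M] [Module R M]
    [AddCommGroup N] [Module R N] (i : ℕ) : Prop := Subsingleton (EM R M N i)

lemma extV_iff {i : ℕ} : ExtV R M N i ↔ ∀ x : EM R M N i, x = 0 :=
  ⟨fun h x => h.elim x 0, fun h => ⟨fun x y => (h x).trans (h y).symm⟩⟩

namespace SES

variable {f : A →ₗ[R] B} {g : B →ₗ[R] C}

lemma extV_mid (h : SES f g) {i : ℕ} (hA : ExtV R A N i) (hC : ExtV R C N i) : ExtV R B N i := by
  rw [extV_iff] at *
  intro x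
  obtain ⟨y, rfl⟩ := h.pre_exact₂ i (hA (extPre f N i x))
  rw [hC y, map_zero]

lemma extV_left (h : SES f g) {i : ℕ} (hB : ExtV R B N i) (hC : ExtV R C N (i + 1)) :
    ExtV R A N i := by
  rw [extV_iff] at *
  intro x
  obtain ⟨y, rfl⟩ := h.pre_exact₁ i (hC (h.del N i x))
  rw [hB y, map_zero]

lemma extV_right (h : SES f g) {i : ℕ} (hA : ExtV R A N i) (hB : ExtV R B N (i + 1)) :
    ExtV R C N (i + 1) := by
  rw [extV_iff] at *
  intro x
  obtain ⟨y, rfl⟩ := h.pre_exact₃ i (hB (extPre g N (i + 1) x))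
  rw [hA y, map_zero]

lemma extV_comid (h : SES f g) {i : ℕ} (hA : ExtV R N A i) (hC : ExtV R N C i) :
    ExtV R N B i := by
  rw [extV_iff] at *
  intro x
  obtain ⟨y, rfl⟩ := h.post_exact₂ i (hC (extPost N g i x))
  rw [hA y, map_zero]

lemma extV_coright (h : SES f g) {i : ℕ} (hB : ExtV R N B i) (hA : ExtV R N A (i + 1)) :
    ExtV R N C i := by
  rw [extV_iff] at *
  intro x
  obtain ⟨y, rfl⟩ := h.post_exact₃ i (hA (h.codel N i x))
  rw [hB y, map_zero]

end SES

lemma ExtV.retract_left {i : ℕ} (s : A →ₗ[R] B) (r : B →ₗ[R] A) (hrs : r ∘ₗ s = LinearMap.id)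
    (h : ExtV R B N i) : ExtV R A N i := by
  rw [extV_iff] at *
  intro x
  rw [← extPre_id i x, ← hrs, extPre_comp, h (extPre r N i x), map_zero]

lemma ExtV.retract_right {i : ℕ} (s : A →ₗ[R] B) (r : B →ₗ[R] A) (hrs : r ∘ₗ s = LinearMap.id)
    (h : ExtV R N B i) : ExtV R N A i := by
  rw [extV_iff] at *
  intro x
  rw [← extPost_id i x, ← hrs, extPost_comp, h (extPost N s i x), map_zero]

lemma ExtV.congr_left {i : ℕ} (e : A ≃ₗ[R] B) (h : ExtV R B N i) : ExtV R A N i :=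
  h.retract_left e.toLinearMap e.symm.toLinearMap (by ext; simp)

lemma extV_of_subsingleton_left {i : ℕ} [Subsingleton A] : ExtV R A N i := by
  rw [extV_iff]
  intro x
  rw [← extPre_id i x, show (LinearMap.id : A →ₗ[R] A) = (0 : R) • LinearMap.id from
    LinearMap.ext fun _ => Subsingleton.elim _ _, extPre_smul_id, zero_smul]

lemma extV_of_subsingleton_right {i : ℕ} [Subsingleton A] : ExtV R N A i := by
  rw [extV_iff]
  intro x
  rw [← extPost_id i x, show (LinearMap.id : A →ₗ[R] A) = (0 : R) • LinearMap.id from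
    LinearMap.ext fun _ => Subsingleton.elim _ _, extPost_smul_id, zero_smul]

lemma extV_self_succ (i : ℕ) : ExtV R R N (i + 1) := by
  rw [extV_iff]
  intro x
  have : Projective (ModuleCat.of R R) := inferInstance
  exact Abelian.Ext.eq_zero_of_projective x

/-- `Ext^0` is `Hom`. -/
def extZeroEquiv : EM R M N 0 ≃ₗ[R] (M →ₗ[R] N) :=
  Abelian.Ext.linearEquiv₀.trans ModuleCat.homLinearEquiv

lemma extV_zero_iff : ExtV R M N 0 ↔ ∀ f : M →ₗ[R] N, f = 0 := by
  rw [extV_iff]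
  constructor
  · intro h f
    rw [← extZeroEquiv.apply_symm_apply f, h (extZeroEquiv.symm f), map_zero]
  · intro h x
    rw [← extZeroEquiv.symm_apply_apply x, h (extZeroEquiv x), map_zero]

lemma extZeroEquiv_symm_apply (u : M →ₗ[R] N) :
    extZeroEquiv.symm u = Abelian.Ext.mk₀ (ModuleCat.ofHom u) := rfl

lemma extPre_zeroEquiv_symm (f : A →ₗ[R] B) (u : B →ₗ[R] N) :
    extPre f N 0 (extZeroEquiv.symm u) = extZeroEquiv.symm (u ∘ₗ f) := by
  rw [extPre_apply, extZeroEquiv_symm_apply, extZeroEquiv_symm_apply, Abelian.Ext.mk₀_comp_mk₀,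
    ModuleCat.ofHom_comp]

lemma extPost_zeroEquiv_symm (f : M →ₗ[R] N) (u : A →ₗ[R] M) :
    extPost A f 0 (extZeroEquiv.symm u) = extZeroEquiv.symm (f ∘ₗ u) := by
  rw [extPost_apply, extZeroEquiv_symm_apply, extZeroEquiv_symm_apply, Abelian.Ext.mk₀_comp_mk₀,
    ModuleCat.ofHom_comp]

namespace SES

variable {f : A →ₗ[R] B} {g : B →ₗ[R] C}

lemma extend_iff (h : SES f g) (u : A →ₗ[R] N) :
    (∃ v : B →ₗ[R] N, v ∘ₗ f = u) ↔ h.del N 0 (extZeroEquiv.symm u) = 0 := by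
  constructor
  · rintro ⟨v, rfl⟩
    rw [← extPre_zeroEquiv_symm, h.del_pre]
  · intro hu
    obtain ⟨y, hy⟩ := h.pre_exact₁ 0 hu
    refine ⟨extZeroEquiv y, extZeroEquiv.symm.injective ?_⟩
    rw [← hy, ← extPre_zeroEquiv_symm, LinearEquiv.symm_apply_apply]

lemma extend (h : SES f g) (hC : ExtV R C N 1) (u : A →ₗ[R] N) : ∃ v : B →ₗ[R] N, v ∘ₗ f = u :=
  (h.extend_iff u).2 (extV_iff.1 hC _)

lemma lift (h : SES f g) (hA : ExtV R N A 1) (u : N →ₗ[R] C) : ∃ v : N →ₗ[R] B, g ∘ₗ v = u := by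
  obtain ⟨y, hy⟩ := h.post_exact₃ 0 (extV_iff.1 hA (h.codel N 0 (extZeroEquiv.symm u)))
  refine ⟨extZeroEquiv y, extZeroEquiv.symm.injective ?_⟩
  rw [← hy, ← extPost_zeroEquiv_symm, LinearEquiv.symm_apply_apply]

end SES

instance finite_EM [IsNoetherianRing R] [Module.Finite R M] [Module.Finite R N] (i : ℕ) :
    Module.Finite R (EM R M N i) :=
  ModuleCat.finite_ext R _ _ i

end ExtToolkit

section Bridge

variable {R : Type} [CommRing R] {X Y : ModuleCat.{0} R}

open CochainComplex HomComplex in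
lemma extMk_zero_degree_eq_zero (P : ProjectiveResolution X) (f : P.complex.X 0 ⟶ Y)
    (hf : P.complex.d 1 0 ≫ f = 0) (h0 : P.extMk f 1 rfl hf = 0) : f = 0 := by
  rw [← P.extEquivCohomologyClass.apply_eq_iff_eq, P.extEquivCohomologyClass_extMk,
    P.extEquivCohomologyClass_zero, CohomologyClass.mk_eq_zero_iff,
    Cocycle.toSingleMk_mem_coboundaries_iff _ _ _ _ _ 1 (by lia)] at h0
  obtain ⟨g, hg⟩ := h0
  have hz : Limits.IsZero (P.cochainComplex.X 1) :=
    CochainComplex.isZero_of_isStrictlyLE _ 0 1 (by lia)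
  rw [hz.eq_of_src g 0, Limits.comp_zero] at hg
  rw [← cancel_epi (P.cochainComplexXIso (-((0 : ℕ) : ℤ)) 0 rfl).hom, ← hg, Limits.comp_zero]

lemma smul_extMk (P : ProjectiveResolution X) {n : ℕ} (f : P.complex.X n ⟶ Y)
    (hf : P.complex.d (n + 1) n ≫ f = 0) (r : R) :
    P.extMk (r • f) (n + 1) rfl (by simp [hf]) = r • P.extMk f (n + 1) rfl hf := by
  rw [Abelian.Ext.smul_eq_comp_mk₀, P.extMk_comp_mk₀]
  simp

/-- Cocycles of the Yoneda complex represent `Ext` classes. -/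
def cocycleToExt (P : ProjectiveResolution X) (i n : ℕ) :
    LinearMap.ker ((P.complex.linearYonedaObj R Y).sc' i n (n + 1)).g.hom →ₗ[R]
      Abelian.Ext X Y n where
  toFun f := P.extMk (Y := Y) f.1 (n + 1) rfl f.2
  map_add' f g := (P.add_extMk (Y := Y) f.1 g.1 (n + 1) rfl f.2 g.2).symm
  map_smul' r f := by
    exact smul_extMk P f.1 f.2 r

lemma cocycleToExt_surjective (P : ProjectiveResolution X) (i n : ℕ) :
    Function.Surjective (cocycleToExt (Y := Y) P i n) := by
  intro α
  obtain ⟨f, hf, rfl⟩ := P.extMk_surjective α (n + 1) rfl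
  exact ⟨⟨f, hf⟩, rfl⟩

lemma ker_cocycleToExt (P : ProjectiveResolution X) (n : ℕ) :
    LinearMap.ker (cocycleToExt (Y := Y) P ((ComplexShape.up ℕ).prev n) n) =
      LinearMap.range ((P.complex.linearYonedaObj R Y).sc'
        ((ComplexShape.up ℕ).prev n) n (n + 1)).moduleCatToCycles := by
  cases n with
  | zero =>
    ext ⟨f, hf⟩
    constructor
    · intro h
      have : f = 0 := extMk_zero_degree_eq_zero P f hf h
      subst this
      exact zero_mem _
    · rintro ⟨g, hg⟩
      have hd : ((P.complex.linearYonedaObj R Y).sc' ((ComplexShape.up ℕ).prev 0) 0 1).f = 0 :=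
        (P.complex.linearYonedaObj R Y).shape _ _ (by simp)
      have h2 := congrArg Subtype.val hg
      have h3 : f = 0 := by
        refine Eq.trans h2.symm ?_
        change ((P.complex.linearYonedaObj R Y).sc' ((ComplexShape.up ℕ).prev 0) 0 1).f.hom g = 0
        rw [hd]; rfl
      subst h3
      exact map_zero _
  | succ n =>
    rw [show (ComplexShape.up ℕ).prev (n + 1) = n by simp]
    ext ⟨f, hf⟩
    rw [LinearMap.mem_ker]
    refine (P.extMk_eq_zero_iff (f : P.complex.X (n + 1) ⟶ Y) (n + 1 + 1) rfl hf n rfl).trans ?_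
    constructor
    · rintro ⟨g, hg⟩
      exact ⟨g, Subtype.ext hg⟩
    · rintro ⟨g, hg⟩
      exact ⟨g, congrArg Subtype.val hg⟩

/-- The left-derived `Ext` agrees with `Ext` in the derived category. -/
def modExtEquiv (X Y : ModuleCat.{0} R) (n : ℕ) : ModExt R n X Y ≃ₗ[R] Abelian.Ext X Y n :=
  let P := projectiveResolution X
  (((P.isoExt n Y) ≪≫ (P.complex.linearYonedaObj R Y).homologyIsoSc'
    ((ComplexShape.up ℕ).prev n) n (n + 1) rfl (by simp)) ≪≫
    ShortComplex.moduleCatHomologyIso _).toLinearEquiv.trans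
    ((Submodule.quotEquivOfEq _ _ (ker_cocycleToExt P n).symm).trans
      ((cocycleToExt P _ n).quotKerEquivOfSurjective (cocycleToExt_surjective P _ n)))

lemma modExt_subsingleton_iff (n : ℕ) :
    Subsingleton (ModExt R n X Y) ↔ ExtV R X Y n :=
  (modExtEquiv X Y n).toEquiv.subsingleton_congr

end Bridge

section Local

open scoped Pointwise

variable {R : Type} [CommRing R]
  {A B C M N P Z : Type} [AddCommGroup A] [Module R A] [AddCommGroup B] [Module R B]
  [AddCommGroup C] [Module R C] [AddCommGroup M] [Module R M] [AddCommGroup N] [Module R N]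
  [AddCommGroup P] [Module R P] [AddCommGroup Z] [Module R Z]

lemma SES.quotSMulTop {y : R} (hy : IsSMulRegular N y) :
    SES (y • (LinearMap.id : N →ₗ[R] N)) (Submodule.mkQ (y • (⊤ : Submodule R N))) where
  inj := hy
  surj := Submodule.mkQ_surjective _
  exact := by
    intro a
    simp [Submodule.mem_smul_pointwise_iff_exists]

lemma eq_zero_of_mem_smul [IsLocalRing R] [Module.Finite R M] {y : R}
    (hy : y ∈ IsLocalRing.maximalIdeal R) (h : ∀ m : M, ∃ m', m = y • m') (m : M) : m = 0 := by
  have : (⊤ : Submodule R M) = ⊥ := by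
    refine Submodule.eq_bot_of_le_smul_of_le_jacobson_bot (IsLocalRing.maximalIdeal R) ⊤
      Module.Finite.fg_top ?_ (IsLocalRing.maximalIdeal_le_jacobson _)
    rintro m -
    obtain ⟨m', rfl⟩ := h m
    exact Submodule.smul_mem_smul hy trivial
  exact (Submodule.mem_bot R).1 (this ▸ Submodule.mem_top)

lemma isSMulRegular_quotient_prime {q : Ideal R} (hq : q.IsPrime) (e : N ≃ₗ[R] R ⧸ q) {y : R}
    (hy : y ∉ q) : IsSMulRegular N y := by
  rw [e.isSMulRegular_congr]
  intro a b hab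
  induction a using Submodule.Quotient.induction_on with | _ a
  induction b using Submodule.Quotient.induction_on with | _ b
  have hab : Ideal.Quotient.mk q (y * a) = Ideal.Quotient.mk q (y * b) := hab
  rw [Ideal.Quotient.eq, ← mul_sub] at hab
  exact Ideal.Quotient.eq.2 ((hq.mem_or_mem hab).resolve_left hy)

lemma lt_annihilator_quotSMulTop {q : Ideal R} (e : N ≃ₗ[R] R ⧸ q) {y : R} (hy : y ∉ q) :
    q < q ⊔ Ideal.span {y} ∧ q ⊔ Ideal.span {y} ≤ Module.annihilator R (QuotSMulTop y N) := by
  constructor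
  · rw [left_lt_sup]
    exact fun h => hy (h (Ideal.mem_span_singleton_self y))
  · apply sup_le
    · refine le_trans ?_ (LinearMap.annihilator_le_of_surjective
        (Submodule.mkQ (y • (⊤ : Submodule R N))) (Submodule.mkQ_surjective _))
      rw [e.annihilator_eq, Ideal.annihilator_quotient]
    · rw [Ideal.span_singleton_le_iff_mem, Module.mem_annihilator]
      intro m
      induction m using Submodule.Quotient.induction_on with | _ m
      rw [← Submodule.Quotient.mk_smul, Submodule.Quotient.mk_eq_zero]
      exact Submodule.smul_mem_pointwise_smul _ _ _ trivial

variable [IsNoetherianRing R]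

/-- Modules killed by `I` are filtered by the `R ⧸ q` for primes `q ≥ I`. -/
lemma prime_filtration (I : Ideal R)
    (P : (N : Type) → [AddCommGroup N] → [Module R N] → [Module.Finite R N] → Prop)
    (zero : ∀ (N : Type) [AddCommGroup N] [Module R N] [Module.Finite R N] [Subsingleton N], P N)
    (ext : ∀ (A : Type) [AddCommGroup A] [Module R A] [Module.Finite R A]
      (B : Type) [AddCommGroup B] [Module R B] [Module.Finite R B]
      (C : Type) [AddCommGroup C] [Module R C] [Module.Finite R C]
      (f : A →ₗ[R] B) (g : B →ₗ[R] C), SES f g → P A → P C → P B)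
    (prime : ∀ (N : Type) [AddCommGroup N] [Module R N] [Module.Finite R N] (q : Ideal R),
      q.IsPrime → I ≤ q → (N ≃ₗ[R] R ⧸ q) → P N)
    (N : Type) [AddCommGroup N] [Module R N] [hN : Module.Finite R N]
    (hI : I ≤ Module.annihilator R N) : P N := by
  revert hI
  induction hN using IsNoetherianRing.induction_on_isQuotientEquivQuotientPrime R with
  | subsingleton N => exact fun _ => zero N
  | quotient N p e =>
    intro h
    refine prime N p.1 p.2 (h.trans ?_) e
    rw [e.annihilator_eq, Ideal.annihilator_quotient]
  | exact A B C f g hf hg hfg hA hC =>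
    intro h
    exact ext A B C f g ⟨hf, hg, hfg⟩ (hA (h.trans (f.annihilator_le_of_injective hf)))
      (hC (h.trans (g.annihilator_le_of_surjective hg)))

variable [IsLocalRing R]

lemma extV_of_quotSMulTop [Module.Finite R N] [Module.Finite R Z] {y : R}
    (hy : y ∈ IsLocalRing.maximalIdeal R) (hreg : IsSMulRegular N y) {i : ℕ}
    (h : ExtV R (QuotSMulTop y N) Z (i + 1)) : ExtV R N Z i := by
  rw [extV_iff]
  refine eq_zero_of_mem_smul hy fun x => ?_
  obtain ⟨x', hx'⟩ := (SES.quotSMulTop hreg).pre_exact₁ i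
    (extV_iff.1 h ((SES.quotSMulTop hreg).del Z i x))
  exact ⟨x', by rw [← hx', extPre_smul_id]⟩

/-- A property of finitely generated modules that holds for the residue field and is stable under
extensions and under lifting along quotients by regular elements holds for all modules. -/
lemma devissage
    (P : (N : Type) → [AddCommGroup N] → [Module R N] → [Module.Finite R N] → Prop)
    (zero : ∀ (N : Type) [AddCommGroup N] [Module R N] [Module.Finite R N] [Subsingleton N], P N)
    (residue : ∀ (N : Type) [AddCommGroup N] [Module R N] [Module.Finite R N],
      (N ≃ₗ[R] IsLocalRing.ResidueField R) → P N)
    (ext : ∀ (A : Type) [AddCommGroup A] [Module R A] [Module.Finite R A]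
      (B : Type) [AddCommGroup B] [Module R B] [Module.Finite R B]
      (C : Type) [AddCommGroup C] [Module R C] [Module.Finite R C]
      (f : A →ₗ[R] B) (g : B →ₗ[R] C), SES f g → P A → P C → P B)
    (regular : ∀ (N : Type) [AddCommGroup N] [Module R N] [Module.Finite R N] (y : R),
      y ∈ IsLocalRing.maximalIdeal R → IsSMulRegular N y → P (QuotSMulTop y N) → P N)
    (N : Type) [AddCommGroup N] [Module R N] [Module.Finite R N] : P N := by
  suffices H : ∀ (I : Ideal R) (N : Type) [AddCommGroup N] [Module R N] [Module.Finite R N],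
      I ≤ Module.annihilator R N → P N from H ⊥ N bot_le
  intro I
  induction I using WellFoundedGT.induction with | _ I ih
  refine prime_filtration I P zero ext ?_
  intro N _ _ _ q hq hIq e
  rcases (IsLocalRing.le_maximalIdeal hq.ne_top).eq_or_lt with h | h
  · subst h
    exact residue N e
  · obtain ⟨y, hy, hyq⟩ := SetLike.exists_of_lt h
    obtain ⟨h1, h2⟩ := lt_annihilator_quotSMulTop e hyq
    exact regular N y hy (isSMulRegular_quotient_prime hq e hyq)
      (ih _ (hIq.trans_lt h1) (QuotSMulTop y N) h2)

end Local

section Depth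

open scoped Pointwise

open IsLocalRing (ResidueField maximalIdeal)

/-- Finite injective dimension of an unbundled module. -/
def FID (R : Type) [CommRing R] (Y : Type) [AddCommGroup Y] [Module R Y] : Prop :=
  ∃ n : ℕ, ∀ (N : Type) [AddCommGroup N] [Module R N] (i : ℕ), n < i → ExtV R N Y i

/-- `depth X ≥ d`, in terms of `Ext`. -/
def Deep (R : Type) [CommRing R] [IsLocalRing R] (d : ℕ) (X : Type) [AddCommGroup X]
    [Module R X] : Prop :=
  ∀ l < d, ExtV R (ResidueField R) X l

/-- `R` is Cohen-Macaulay of dimension `d`. -/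
structure CMDim (R : Type) [CommRing R] [IsLocalRing R] (d : ℕ) : Prop where
  deep : Deep R d R
  top : ¬ ExtV R (ResidueField R) R d
  dim : ringKrullDim R = d

variable {R : Type} [CommRing R]
  {A B C M N P Z Y : Type} [AddCommGroup A] [Module R A] [AddCommGroup B] [Module R B]
  [AddCommGroup C] [Module R C] [AddCommGroup M] [Module R M] [AddCommGroup N] [Module R N]
  [AddCommGroup P] [Module R P] [AddCommGroup Z] [Module R Z] [AddCommGroup Y] [Module R Y]

lemma SES.fid_mid {f : A →ₗ[R] B} {g : B →ₗ[R] C} (h : SES f g) (hA : FID R A) (hC : FID R C) :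
    FID R B := by
  obtain ⟨a, ha⟩ := hA
  obtain ⟨c, hc⟩ := hC
  exact ⟨max a c, fun N _ _ i hi => h.extV_comid (ha N i (by lia)) (hc N i (by lia))⟩

lemma SES.fid_right {f : A →ₗ[R] B} {g : B →ₗ[R] C} (h : SES f g) (hA : FID R A)
    (hB : FID R B) : FID R C := by
  obtain ⟨a, ha⟩ := hA
  obtain ⟨c, hc⟩ := hB
  exact ⟨max a c, fun N _ _ i hi => h.extV_coright (hc N i (by lia)) (ha N (i + 1) (by lia))⟩

lemma FID.retract (s : A →ₗ[R] B) (r : B →ₗ[R] A) (hrs : r ∘ₗ s = LinearMap.id)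
    (h : FID R B) : FID R A := by
  obtain ⟨n, hn⟩ := h
  exact ⟨n, fun N _ _ i hi => (hn N i hi).retract_right s r hrs⟩

lemma SES.mkQ_range {f : A →ₗ[R] B} (hf : Function.Injective f) :
    SES f (LinearMap.range f).mkQ where
  inj := hf
  surj := Submodule.mkQ_surjective _
  exact := by
    intro x
    simp

variable [IsLocalRing R]

lemma Deep.retract {d : ℕ} (s : A →ₗ[R] B) (r : B →ₗ[R] A) (hrs : r ∘ₗ s = LinearMap.id)
    (h : Deep R d B) : Deep R d A :=
  fun l hl => (h l hl).retract_right s r hrs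

lemma exact_quotSMulTop_deep {e : ℕ} {y : R} (hreg : IsSMulRegular N y)
    (h : Deep R (e + 1) N) : Deep R e (QuotSMulTop y N) := fun l hl =>
  (SES.quotSMulTop hreg).extV_coright (h l (by lia)) (h (l + 1) (by lia))

lemma smul_ext_residueField {y : R} (hy : y ∈ maximalIdeal R) {i : ℕ}
    (x : EM R (ResidueField R) N i) : y • x = 0 := by
  rw [← extPre_smul_id]
  have : y • (LinearMap.id : ResidueField R →ₗ[R] ResidueField R) = 0 := by
    ext c
    change IsLocalRing.residue R y * c = 0
    rw [(IsLocalRing.residue_eq_zero_iff _).2 hy, zero_mul]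
  rw [this, show (0 : ResidueField R →ₗ[R] ResidueField R) = (0 : R) • LinearMap.id by simp,
    extPre_smul_id, zero_smul]

instance isSimpleModule_residueField : IsSimpleModule R (ResidueField R) :=
  isSimpleModule_iff_quot_maximal.2 ⟨maximalIdeal R, inferInstance, ⟨LinearEquiv.refl R _⟩⟩

lemma injective_of_residueField {f : ResidueField R →ₗ[R] N} (hf : f ≠ 0) :
    Function.Injective f := by
  rw [← LinearMap.ker_eq_bot]
  exact (eq_bot_or_eq_top _).resolve_right fun h => hf (LinearMap.ker_eq_top.1 h)

variable [IsNoetherianRing R]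

lemma exists_regular_of_extV_zero [Module.Finite R N] (h : ExtV R (ResidueField R) N 0) :
    ∃ y ∈ maximalIdeal R, IsSMulRegular N y := by
  rw [extV_zero_iff] at h
  have : Subsingleton (ResidueField R →ₗ[R] N) := ⟨fun a b => (h a).trans (h b).symm⟩
  obtain ⟨y, hy, hreg⟩ := IsSMulRegular.subsingleton_linearMap_iff.1 this
  refine ⟨y, ?_, hreg⟩
  have h1 : IsLocalRing.residue R y * 1 = 0 := Module.mem_annihilator.1 hy 1
  rwa [mul_one, IsLocalRing.residue_eq_zero_iff] at h1

lemma exists_finite_projDim {d : ℕ} (h : CMDim R d) (e : ℕ) (he : e ≤ d) :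
    ∃ (N : Type) (_ : AddCommGroup N) (_ : Module R N), Module.Finite R N ∧
      (∀ t, t + e = d → Deep R t N ∧ ¬ ExtV R (ResidueField R) N t) ∧
      ∀ (M : Type) [AddCommGroup M] [Module R M] (i : ℕ), e < i → ExtV R N M i := by
  induction e with
  | zero =>
    refine ⟨R, inferInstance, inferInstance, inferInstance, ?_, ?_⟩
    · rintro t rfl
      exact ⟨h.deep, h.top⟩
    · intro M _ _ i hi
      obtain ⟨i, rfl⟩ := Nat.exists_eq_succ_of_ne_zero hi.ne'
      exact extV_self_succ i
  | succ e ih =>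
    obtain ⟨N, _, _, hfin, hN, hN'⟩ := ih (by lia)
    obtain ⟨t, rfl⟩ := Nat.exists_eq_add_of_le' he
    obtain ⟨hdeep, htop⟩ := hN (t + 1) (by lia)
    obtain ⟨y, hy, hreg⟩ := exists_regular_of_extV_zero (hdeep 0 (by lia))
    refine ⟨QuotSMulTop y N, inferInstance, inferInstance, inferInstance, ?_, ?_⟩
    · intro t' ht'
      obtain rfl : t' = t := by lia
      refine ⟨exact_quotSMulTop_deep hreg hdeep, fun hv => htop ?_⟩
      rw [extV_iff] at hv ⊢
      intro x
      obtain ⟨z, rfl⟩ := (SES.quotSMulTop hreg).post_exact₁ t' (x := x) (by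
        rw [extPost_smul_id, smul_ext_residueField hy])
      rw [hv z, map_zero]
    · intro M _ _ i hi
      obtain ⟨i, rfl⟩ := Nat.exists_eq_succ_of_ne_zero (show i ≠ 0 by lia)
      exact (SES.quotSMulTop hreg).extV_right (hN' M i (by lia)) (hN' M (i + 1) (by lia))

/-- The injective dimension is bounded by the dimension. -/
lemma FID.extV_of_lt {d : ℕ} (h : CMDim R d) [Module.Finite R Y] (hY : FID R Y)
    (N : Type) [AddCommGroup N] [Module R N] [Module.Finite R N] {i : ℕ} (hi : d < i) :
    ExtV R N Y i := by
  obtain ⟨n, hn⟩ := hY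
  obtain ⟨D, _, _, _, hD, hD'⟩ := exists_finite_projDim h d le_rfl
  obtain ⟨f, hf⟩ : ∃ f : ResidueField R →ₗ[R] D, f ≠ 0 := by
    have := (hD 0 (by lia)).2
    rw [extV_zero_iff] at this
    push Not at this
    exact this
  have hses := SES.mkQ_range (injective_of_residueField hf)
  have key : ∀ (t r : ℕ), d < r → n < r + t → ∀ (N : Type) [AddCommGroup N] [Module R N]
      [Module.Finite R N], ExtV R N Y r := by
    intro t
    induction t with
    | zero => intro r _ hr N _ _ _; exact hn N r (by lia)
    | succ t ih =>
      intro r hr hrt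
      have hk : ExtV R (ResidueField R) Y r :=
        hses.extV_left (hD' Y r hr) (ih (r + 1) (by lia) (by lia) _)
      refine devissage (fun N _ _ _ => ExtV R N Y r) ?_ ?_ ?_ ?_
      · intros; exact extV_of_subsingleton_left
      · intro N _ _ _ e; exact hk.congr_left e
      · intro A _ _ _ B _ _ _ C _ _ _ f g hs hA hC; exact hs.extV_mid hA hC
      · intro N _ _ _ y hy hreg _
        exact extV_of_quotSMulTop hy hreg (ih (r + 1) (by lia) (by lia) _)
  exact key n i hi (by lia) N

lemma Deep.extV {d e : ℕ} (h : CMDim R d) [Module.Finite R Y] (hY : FID R Y)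
    (N : Type) [AddCommGroup N] [Module R N] [Module.Finite R N] (hN : Deep R e N) {i : ℕ}
    (hi : d < i + e) : ExtV R N Y i := by
  induction e generalizing N i with
  | zero => exact hY.extV_of_lt h N hi
  | succ e ih =>
    obtain ⟨y, hy, hreg⟩ := exists_regular_of_extV_zero (hN 0 (by lia))
    exact extV_of_quotSMulTop hy hreg (ih _ (exact_quotSMulTop_deep hreg hN) (by lia))

/-- Vanishing of `Ext^i(N, X)` for `i + dim N < depth X`. -/
lemma extV_of_coheight_le {d : ℕ} {X : Type} [AddCommGroup X] [Module R X] [Module.Finite R X]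
    (hX : Deep R d X) (j : ℕ) (I : Ideal R)
    (hI : ∀ q : PrimeSpectrum R, I ≤ q.asIdeal → Order.coheight q ≤ j) {i : ℕ} (hij : i + j < d)
    (N : Type) [AddCommGroup N] [Module R N] [Module.Finite R N]
    (hN : I ≤ Module.annihilator R N) : ExtV R N X i := by
  induction j generalizing I i N with
  | zero =>
    refine prime_filtration I (fun N _ _ _ => ExtV R N X i) ?_ ?_ ?_ N hN
    · intros; exact extV_of_subsingleton_left
    · intro A _ _ _ B _ _ _ C _ _ _ f g hs hA hC; exact hs.extV_mid hA hC
    · intro N _ _ _ q hq hIq e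
      have hmax : IsMax (⟨q, hq⟩ : PrimeSpectrum R) :=
        Order.coheight_eq_zero.1 (by simpa using hI ⟨q, hq⟩ hIq)
      have : q = maximalIdeal R := le_antisymm (IsLocalRing.le_maximalIdeal hq.ne_top)
        (hmax (b := IsLocalRing.closedPoint R) (IsLocalRing.le_maximalIdeal hq.ne_top))
      subst this
      exact (hX i (by lia)).congr_left e
  | succ j ih =>
    refine prime_filtration I (fun N _ _ _ => ExtV R N X i) ?_ ?_ ?_ N hN
    · intros; exact extV_of_subsingleton_left
    · intro A _ _ _ B _ _ _ C _ _ _ f g hs hA hC; exact hs.extV_mid hA hC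
    · intro N _ _ _ q hq hIq e
      rcases (IsLocalRing.le_maximalIdeal hq.ne_top).eq_or_lt with h | h
      · subst h
        exact (hX i (by lia)).congr_left e
      · obtain ⟨y, hy, hyq⟩ := SetLike.exists_of_lt h
        obtain ⟨h1, h2⟩ := lt_annihilator_quotSMulTop e hyq
        refine extV_of_quotSMulTop hy (isSMulRegular_quotient_prime hq e hyq)
          (ih (q ⊔ Ideal.span {y}) ?_ (by lia) _ h2)
        intro p hp
        have hlt : (⟨q, hq⟩ : PrimeSpectrum R) < p := h1.trans_le hp
        have := (Order.coheight_add_one_le hlt).trans (hI ⟨q, hq⟩ hIq)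
        rw [Nat.cast_add, Nat.cast_one] at this
        exact (ENat.add_le_add_iff_right (by simp)).1 this

/-- Associated primes of maximal Cohen-Macaulay modules are minimal. -/
lemma Deep.minimal_of_hom {d : ℕ} (h : CMDim R d) {X : Type} [AddCommGroup X] [Module R X]
    [Module.Finite R X] (hX : Deep R d X) {p : Ideal R} (hp : p.IsPrime) {f : (R ⧸ p) →ₗ[R] X}
    (hf : f ≠ 0) {q : Ideal R} (hq : q.IsPrime) (hqp : q ≤ p) : q = p := by
  by_contra hne
  have hlt : (⟨q, hq⟩ : PrimeSpectrum R) < ⟨p, hp⟩ :=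
    lt_of_le_of_ne hqp fun h => hne (congrArg PrimeSpectrum.asIdeal h)
  have hle : ∀ q : PrimeSpectrum R, Order.coheight q ≤ d := fun q => by
    have := Order.coheight_le_krullDim q
    have hd : Order.krullDim (PrimeSpectrum R) = (d : WithBot ℕ∞) := h.dim
    rw [hd] at this
    exact_mod_cast this
  have hp1 := (Order.coheight_add_one_le hlt).trans (hle _)
  obtain ⟨j, rfl⟩ : ∃ j, d = j + 1 := by
    cases d with
    | zero => simp at hp1
    | succ j => exact ⟨j, rfl⟩
  rw [Nat.cast_add, Nat.cast_one] at hp1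
  have hp2 := (ENat.add_le_add_iff_right (by simp)).1 hp1
  have := extV_of_coheight_le hX j p (i := 0)
    (fun q hq => (Order.coheight_anti (show (⟨p, hp⟩ : PrimeSpectrum R) ≤ q from hq)).trans hp2)
    (by lia) (R ⧸ p) (by rw [Ideal.annihilator_quotient])
  exact hf (extV_zero_iff.1 this f)

end Depth

section Canonical

open scoped Pointwise

open IsLocalRing (ResidueField maximalIdeal)

variable {R : Type} [CommRing R]
  {A B C M N P Z Y X : Type} [AddCommGroup A] [Module R A] [AddCommGroup B] [Module R B]
  [AddCommGroup C] [Module R C] [AddCommGroup M] [Module R M] [AddCommGroup N] [Module R N]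
  [AddCommGroup P] [Module R P] [AddCommGroup Z] [Module R Z] [AddCommGroup Y] [Module R Y]
  [AddCommGroup X] [Module R X]

lemma smul_ext_eq_zero {s : R} (hs : ∀ n : N, s • n = 0) {i : ℕ} (x : EM R N Z i) :
    s • x = 0 := by
  rw [← extPre_smul_id, show s • (LinearMap.id : N →ₗ[R] N) = (0 : R) • LinearMap.id from
    LinearMap.ext fun n => by simp [hs n], extPre_smul_id, zero_smul]

lemma exists_quotient_injective (p : Ideal R) (v : X) (hv : ∀ a : R, a • v = 0 ↔ a ∈ p) :
    ∃ g : (R ⧸ p) →ₗ[R] X, Function.Injective g ∧ g (Ideal.Quotient.mk p 1) = v := by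
  have hle : p ≤ LinearMap.ker (LinearMap.toSpanSingleton R X v) := fun a ha => by
    simpa [hv] using ha
  refine ⟨Submodule.liftQ p (LinearMap.toSpanSingleton R X v) hle, ?_, ?_⟩
  · rw [← LinearMap.ker_eq_bot]
    refine Submodule.ker_liftQ_eq_bot _ _ _ fun a ha => ?_
    simpa [hv] using ha
  · exact (Submodule.liftQ_apply _ _ _).trans (one_smul R v)

lemma extV_pi {n i : ℕ} (h : ExtV R N Z i) : ExtV R N (Fin n → Z) i := by
  rw [extV_iff] at *
  intro x
  have hid : (LinearMap.id : (Fin n → Z) →ₗ[R] (Fin n → Z)) =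
      ∑ j, LinearMap.single R (fun _ => Z) j ∘ₗ LinearMap.proj j := by
    refine LinearMap.ext fun v => ?_
    simpa using (LinearMap.sum_single_apply (fun _ => Z) v).symm
  rw [← extPost_id i x, hid, extPost_sum]
  refine Finset.sum_eq_zero fun j _ => ?_
  rw [extPost_comp, h (extPost N (LinearMap.proj j) i x), map_zero]

lemma exists_smul_eq_zero_iff_of_minimal [IsNoetherianRing R] {p : Ideal R} (hp : p.IsPrime)
    (hmin : ∀ q : Ideal R, q.IsPrime → q ≤ p → q = p) :
    ∃ r : R, ∀ a : R, a • r = 0 ↔ a ∈ p := by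
  have hmem : p ∈ (Module.annihilator R R).minimalPrimes :=
    ⟨⟨hp, fun a ha => by
      rw [show a = 0 by simpa using Module.mem_annihilator.1 ha 1]; exact zero_mem p⟩,
      fun q hq hqp => (hmin q hq.1 hqp).ge⟩
  obtain ⟨-, r, hr⟩ := isAssociatedPrime_iff.1
    (Module.associatedPrimes.minimalPrimes_annihilator_subset_associatedPrimes R R hmem)
  exact ⟨r, fun a => by rw [hr, Submodule.mem_colon_singleton, Submodule.mem_bot]⟩

variable [IsLocalRing R]

lemma Deep.pi {n d : ℕ} (h : Deep R d Z) : Deep R d (Fin n → Z) := fun l hl => extV_pi (h l hl)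

variable [IsNoetherianRing R]

/-- `Ext^i(-, Z)` vanishes at a minimal prime `p` for `i > 0`. -/
lemma FID.exists_smul_eq_zero {d : ℕ} (h : CMDim R d) [Module.Finite R Z] (hZ : FID R Z)
    {p : Ideal R} (hp : p.IsPrime) (hmin : ∀ q : Ideal R, q.IsPrime → q ≤ p → q = p)
    {r : R} (hr : ∀ a : R, a • r = 0 ↔ a ∈ p) (i : ℕ)
    (N : Type) [AddCommGroup N] [Module R N] [Module.Finite R N] (x : EM R N Z (i + 1)) :
    ∃ s ∉ p, s • x = 0 := by
  suffices key : ∀ t i : ℕ, d < i + 1 + t → ∀ (N : Type) [AddCommGroup N] [Module R N]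
      [Module.Finite R N] (x : EM R N Z (i + 1)), ∃ s ∉ p, s • x = 0 from
    key d i (by lia) N x
  intro t
  induction t with
  | zero =>
    intro i hi N _ _ _ x
    exact ⟨1, fun h => hp.ne_top ((Ideal.eq_top_iff_one _).2 h),
      by rw [extV_iff.1 (hZ.extV_of_lt h N hi) x, smul_zero]⟩
  | succ t ih =>
    intro i hi N _ _ _
    refine prime_filtration ⊥ (fun (N : Type) [AddCommGroup N] [Module R N] [Module.Finite R N] =>
      ∀ x : EM R N Z (i + 1), ∃ s ∉ p, s • x = 0)
      ?_ ?_ ?_ N bot_le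
    · intro N _ _ _ _ x
      exact ⟨1, fun h => hp.ne_top ((Ideal.eq_top_iff_one _).2 h),
        by rw [extV_iff.1 extV_of_subsingleton_left x, smul_zero]⟩
    · intro A _ _ _ B _ _ _ C _ _ _ f g hs hA hC x
      obtain ⟨s, hsp, hsx⟩ := hA (extPre f Z _ x)
      obtain ⟨y, hy⟩ := hs.pre_exact₂ (i + 1) (x := s • x) (by rw [map_smul, hsx])
      obtain ⟨s', hsp', hsy⟩ := hC y
      exact ⟨s' * s, fun h => (hp.mem_or_mem h).elim hsp' hsp,
        by rw [mul_smul, ← hy, ← map_smul, hsy, map_zero]⟩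
    · intro N _ _ _ q hq _ e x
      by_cases hqp : q ≤ p
      · obtain rfl := hmin q hq hqp
        obtain ⟨g, hg, -⟩ := exists_quotient_injective q r hr
        have hs := SES.mkQ_range (f := g ∘ₗ e.toLinearMap) (hg.comp e.injective)
        obtain ⟨s, hsp, hsx⟩ := ih (i + 1) (by lia) _ (hs.del Z (i + 1) x)
        obtain ⟨y, hy⟩ := hs.pre_exact₁ (i + 1) (x := s • x) (by rw [map_smul, hsx])
        exact ⟨s, hsp, by rw [← hy, extV_iff.1 (extV_self_succ i) y, map_zero]⟩
      · obtain ⟨s, hsq, hsp⟩ := SetLike.not_le_iff_exists.1 hqp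
        refine ⟨s, hsp, smul_ext_eq_zero (fun n => ?_) x⟩
        have : s ∈ Module.annihilator R N := by rwa [e.annihilator_eq, Ideal.annihilator_quotient]
        exact Module.mem_annihilator.1 this n

/-- Maximal Cohen-Macaulay modules are torsionless with respect to an ideal of finite injective
dimension containing a regular element. -/
lemma Deep.exists_apply_ne_zero {d : ℕ} (h : CMDim R d) [Module.Finite R X] (hX : Deep R d X)
    {ω : Ideal R} (hω : FID R ω) {x : R} (hxω : x ∈ ω) (hx : x ∈ nonZeroDivisors R)
    {K : Submodule R X} (hK : K ≠ ⊥) : ∃ f : X →ₗ[R] ω, ∃ v ∈ K, f v ≠ 0 := by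
  have : Nontrivial K := (Submodule.nontrivial_iff_ne_bot).2 hK
  obtain ⟨p, hpK⟩ := associatedPrimes.nonempty R K
  obtain ⟨hp, ⟨v, hvK⟩, hv⟩ := isAssociatedPrime_iff.1 hpK
  have hv' : ∀ a : R, a • v = 0 ↔ a ∈ p := fun a => by
    rw [hv, Submodule.mem_colon_singleton, Submodule.mem_bot, Subtype.ext_iff]
    rfl
  obtain ⟨g, hg, hg1⟩ := exists_quotient_injective p v hv'
  have hg0 : g ≠ 0 := by
    rintro rfl
    refine hp.ne_top ((Ideal.eq_top_iff_one _).2 ((hv' 1).1 ?_))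
    rw [← hg1, LinearMap.zero_apply, smul_zero]
  have hmin : ∀ q : Ideal R, q.IsPrime → q ≤ p → q = p := fun q hq hqp =>
    hX.minimal_of_hom h hp hg0 hq hqp
  obtain ⟨r, hr⟩ := exists_smul_eq_zero_iff_of_minimal hp hmin
  let w : ω := ⟨r * x, ω.mul_mem_left r hxω⟩
  have hw : ∀ a : R, a • w = 0 ↔ a ∈ p := fun a => by
    rw [← hr, Subtype.ext_iff]
    change a * (r * x) = 0 ↔ a * r = 0
    rw [← mul_assoc]
    exact mul_right_mem_nonZeroDivisors_eq_zero_iff hx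
  obtain ⟨u, -, hu1⟩ := exists_quotient_injective p w hw
  have hs := SES.mkQ_range hg
  obtain ⟨s, hsp, hsu⟩ := hω.exists_smul_eq_zero h hp hmin hr 0 _
    (hs.del ω 0 (extZeroEquiv.symm u))
  obtain ⟨f, hf⟩ := (hs.extend_iff (s • u)).2 (by rw [map_smul, map_smul, hsu])
  refine ⟨f, v, hvK, fun h0 => hsp ((hw s).1 ?_)⟩
  rw [← h0, ← hg1, ← hu1]
  exact (LinearMap.congr_fun hf _).symm

/-- Vanishing of `Ext` against the canonical module implies vanishing against all modules of
finite injective dimension. -/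
lemma extV_of_canonical {d : ℕ} (h : CMDim R d) [Module.Finite R Z] (hZ : FID R Z)
    (hk : ¬ ExtV R (ResidueField R) Z d) [Module.Finite R Y] (hY : FID R Y) (j : ℕ)
    (N : Type) [AddCommGroup N] [Module R N] [Module.Finite R N]
    (hN : ∀ i > j, ExtV R N Z i) : ∀ i > j, ExtV R N Y i := by
  suffices key : ∀ t j : ℕ, d ≤ j + t → ∀ (N : Type) [AddCommGroup N] [Module R N]
      [Module.Finite R N], (∀ i > j, ExtV R N Z i) → ∀ i > j, ExtV R N Y i from
    key d j (by lia) N hN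
  intro t
  induction t with
  | zero =>
    intro j hj N _ _ _ _ i hi
    exact hY.extV_of_lt h N (by lia)
  | succ t ih =>
    intro j hj N _ _ _ hN i hi
    by_cases hdj : d ≤ j
    · exact hY.extV_of_lt h N (by lia)
    have h0 : ExtV R (ResidueField R) N 0 := by
      rw [extV_zero_iff]
      intro f
      by_contra hf
      exact hk ((SES.mkQ_range (injective_of_residueField hf)).extV_left (hN d (by lia))
        (hZ.extV_of_lt h _ (by lia)))
    obtain ⟨y, hy, hreg⟩ := exists_regular_of_extV_zero h0
    refine extV_of_quotSMulTop hy hreg (ih (j + 1) (by lia) _ ?_ (i + 1) (by lia))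
    intro i' hi'
    obtain ⟨i', rfl⟩ := Nat.exists_eq_add_of_le' (show 1 ≤ i' by lia)
    exact (SES.quotSMulTop hreg).extV_right (hN i' (by lia)) (hN (i' + 1) (by lia))

/-- Maps from a maximal Cohen-Macaulay module to a module of finite injective dimension factor
through a power of the canonical ideal. -/
lemma Deep.exists_factor {d : ℕ} (h : CMDim R d) [Module.Finite R X] (hX : Deep R d X)
    {ω : Ideal R} (hω : FID R ω) (hωd : Deep R d ω) (hk : ¬ ExtV R (ResidueField R) ω d)
    {x : R} (hxω : x ∈ ω) (hx : x ∈ nonZeroDivisors R)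
    [Module.Finite R Y] (hY : FID R Y) (u : X →ₗ[R] Y) :
    ∃ (n : ℕ) (a : X →ₗ[R] (Fin n → ω)) (b : (Fin n → ω) →ₗ[R] Y), b ∘ₗ a = u := by
  have : Module.Finite R (X →ₗ[R] ω) := Module.Finite.equiv (extZeroEquiv (M := X) (N := ω))
  obtain ⟨n, s, hs⟩ := Module.Finite.exists_fin (R := R) (M := X →ₗ[R] ω)
  let φ : X →ₗ[R] (Fin n → ω) := LinearMap.pi s
  have hφ : Function.Injective φ := by
    rw [← LinearMap.ker_eq_bot]
    by_contra hK
    obtain ⟨f, v, hv, hfv⟩ := hX.exists_apply_ne_zero h hω hxω hx hK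
    apply hfv
    have hf : f ∈ Submodule.span R (Set.range s) := hs ▸ Submodule.mem_top
    induction hf using Submodule.span_induction with
    | mem f hf =>
      obtain ⟨i, rfl⟩ := hf
      exact congrFun (LinearMap.mem_ker.1 hv) i
    | zero => rfl
    | add f g _ _ hf hg =>
      by_contra hne
      by_cases h0 : f v = 0
      · by_cases h1 : g v = 0
        · exact hne (by rw [LinearMap.add_apply, h0, h1, add_zero])
        · exact h1 (hg h1)
      · exact h0 (hf h0)
    | smul a f _ hf =>
      by_contra hne
      by_cases h0 : f v = 0
      · exact hne (by rw [LinearMap.smul_apply, h0, smul_zero])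
      · exact h0 (hf h0)
  have hses := SES.mkQ_range hφ
  have hF : ∀ i, 0 < i → ExtV R (Fin n → ω) ω i := fun i hi => (Deep.pi hωd).extV h hω _ (by lia)
  have hXω : ∀ i, 0 < i → ExtV R X ω i := fun i hi => hX.extV h hω _ (by lia)
  have hext : ∀ f : X →ₗ[R] ω, ∃ g : (Fin n → ω) →ₗ[R] ω, g ∘ₗ φ = f := by
    intro f
    have hf : f ∈ Submodule.span R (Set.range s) := hs ▸ Submodule.mem_top
    induction hf using Submodule.span_induction with
    | mem f hf =>
      obtain ⟨i, rfl⟩ := hf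
      exact ⟨LinearMap.proj i, rfl⟩
    | zero => exact ⟨0, rfl⟩
    | add f g _ _ hf hg =>
      obtain ⟨f', rfl⟩ := hf
      obtain ⟨g', rfl⟩ := hg
      exact ⟨f' + g', rfl⟩
    | smul a f _ hf =>
      obtain ⟨f', rfl⟩ := hf
      exact ⟨a • f', rfl⟩
  have hC : ∀ i > 0, ExtV R ((Fin n → ω) ⧸ LinearMap.range φ) ω i := by
    intro i hi
    obtain ⟨i, rfl⟩ := Nat.exists_eq_add_of_le' hi
    cases i with
    | zero =>
      rw [extV_iff]
      intro y
      obtain ⟨f, rfl⟩ := hses.pre_exact₃ 0 (x := y) (extV_iff.1 (hF 1 one_pos) _)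
      obtain ⟨f, rfl⟩ := extZeroEquiv.symm.surjective f
      exact (hses.extend_iff f).1 (hext f)
    | succ i => exact hses.extV_right (hXω (i + 1) (by lia)) (hF _ (by lia))
  obtain ⟨b, hb⟩ := hses.extend (extV_of_canonical h hω hk hY 0 _ hC 1 one_pos) u
  exact ⟨n, φ, b, hb⟩

end Canonical

section Minimal

open scoped Pointwise

open IsLocalRing (ResidueField maximalIdeal)

variable {R : Type} [CommRing R] [IsLocalRing R]
  {M Z Y X Y' X' : Type} [AddCommGroup M] [Module R M]
  [AddCommGroup Z] [Module R Z] [AddCommGroup Y] [Module R Y]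
  [AddCommGroup X] [Module R X] [AddCommGroup Y'] [Module R Y'] [AddCommGroup X'] [Module R X']

/-- `ω` is a canonical ideal, containing a regular element, of the `d`-dimensional Cohen-Macaulay
local ring `R`. -/
structure CanonIdeal (R : Type) [CommRing R] [IsLocalRing R] (d : ℕ) (ω : Ideal R) : Prop where
  cm : CMDim R d
  fid : FID R ω
  low : ∀ i ≠ d, ExtV R (ResidueField R) ω i
  simple : IsSimpleModule R (EM R (ResidueField R) ω d)
  regular : ∃ x ∈ ω, x ∈ nonZeroDivisors R

variable {d : ℕ} {ω : Ideal R}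

lemma CanonIdeal.deep (h : CanonIdeal R d ω) : Deep R d ω := fun l hl => h.low l hl.ne

lemma CanonIdeal.not_extV (h : CanonIdeal R d ω) : ¬ ExtV R (ResidueField R) ω d := by
  have := h.simple
  exact not_subsingleton_iff_nontrivial.2 (IsSimpleModule.nontrivial R _)

lemma CanonIdeal.nontrivial (h : CanonIdeal R d ω) : Nontrivial ω := by
  by_contra hn
  rw [not_nontrivial_iff_subsingleton] at hn
  exact h.not_extV extV_of_subsingleton_right

variable [IsNoetherianRing R]

/-- An endomorphism of a module of finite injective dimension which is surjective on
`Ext` from the residue field is surjective. -/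
lemma FID.surjective_of_ext {d : ℕ} (h : CMDim R d) [Module.Finite R Z] (hZ : FID R Z)
    {φ : Z →ₗ[R] Z} (hφ : ∀ i, Function.Surjective (extPost (ResidueField R) φ i)) :
    Function.Surjective φ := by
  have key := devissage (fun N _ _ _ => ∀ i, Function.Surjective (extPost N φ i))
    (fun N _ _ _ _ i x => ⟨0, (map_zero _).trans (extV_iff.1 extV_of_subsingleton_left x).symm⟩)
    (fun N _ _ _ e i x => by
      obtain ⟨z, hz⟩ := hφ i (extPre e.symm.toLinearMap Z i x)
      refine ⟨extPre e.toLinearMap Z i z, ?_⟩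
      rw [← extPre_extPost, hz, ← extPre_comp, LinearEquiv.symm_comp, extPre_id])
    (fun A _ _ _ B _ _ _ C _ _ _ f g hs hA hC i x => by
      obtain ⟨a, ha⟩ := hA i (extPre f Z i x)
      have hinj := OrzechProperty.injective_of_surjective_endomorphism _ (hC (i + 1))
      have hda : hs.del Z i a = 0 := hinj (by
        rw [← hs.del_extPost, ha, hs.del_pre, map_zero])
      obtain ⟨b, rfl⟩ := hs.pre_exact₁ i hda
      obtain ⟨c, hc⟩ := hs.pre_exact₂ i (x := x - extPost B φ i b) (by
        rw [map_sub, extPre_extPost, ha, sub_self])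
      obtain ⟨c, rfl⟩ := hC i c
      refine ⟨b + extPre g Z i c, ?_⟩
      rw [map_add, ← extPre_extPost, hc, add_sub_cancel])
    (fun N _ _ _ y hy hreg hQ i => by
      have hs := SES.quotSMulTop hreg
      suffices H : ∀ t i, d < i + t → Function.Surjective (extPost N φ i) from
        H (d + 1) i (by lia)
      intro t
      induction t with
      | zero => exact fun i hi x => ⟨0, (extV_iff.1 (hZ.extV_of_lt h N hi) x).symm ▸ map_zero _⟩
      | succ t ih =>
        intro i hi
        have hinj := OrzechProperty.injective_of_surjective_endomorphism _
          (ih (i + 1) (by lia))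
        rw [← LinearMap.range_eq_top, ← Submodule.Quotient.subsingleton_iff]
        refine ⟨fun a b => ?_⟩
        suffices H : ∀ a : EM R N Z i ⧸ LinearMap.range (extPost N φ i), a = 0 from
          (H a).trans (H b).symm
        refine eq_zero_of_mem_smul hy fun m => ?_
        obtain ⟨x, rfl⟩ := Submodule.mkQ_surjective _ m
        obtain ⟨c, hc⟩ := hQ (i + 1) (hs.del Z i x)
        obtain ⟨x', rfl⟩ := hs.pre_exact₃ i (x := c) (hinj (by
          rw [← extPre_extPost, hc, hs.pre_del, map_zero]))
        obtain ⟨x'', hx''⟩ := hs.pre_exact₁ i (x := x - extPost N φ i x') (by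
          rw [map_sub, hs.del_extPost, hc, sub_self])
        refine ⟨Submodule.mkQ _ x'', ?_⟩
        rw [← map_smul, ← sub_eq_zero, ← map_sub, Submodule.mkQ_apply,
          Submodule.Quotient.mk_eq_zero]
        rw [extPre_smul_id] at hx''
        exact ⟨x', by rw [hx'', sub_sub_cancel]⟩)
    R
  intro z
  obtain ⟨u, hu⟩ := key 0 (extZeroEquiv.symm (LinearMap.toSpanSingleton R Z z))
  obtain ⟨u, rfl⟩ := extZeroEquiv.symm.surjective u
  rw [extPost_zeroEquiv_symm] at hu
  have := LinearMap.congr_fun (extZeroEquiv.symm.injective hu) 1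
  exact ⟨u 1, by simpa using this⟩

lemma CanonIdeal.bijective_or_ext_eq_zero (h : CanonIdeal R d ω) (φ : ω →ₗ[R] ω) :
    Function.Bijective φ ∨ ∀ i x, extPost (ResidueField R) φ i x = 0 := by
  have := h.simple
  rcases LinearMap.bijective_or_eq_zero (extPost (ResidueField R) φ d) with hb | h0
  · refine Or.inl (OrzechProperty.bijective_of_surjective_endomorphism φ
      (h.fid.surjective_of_ext h.cm fun i => ?_))
    by_cases hi : i = d
    · subst hi; exact hb.surjective
    · exact fun x => ⟨0, (extV_iff.1 (h.low i hi) x).symm ▸ map_zero _⟩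
  · refine Or.inr fun i x => ?_
    by_cases hi : i = d
    · subst hi; rw [h0]; rfl
    · exact extV_iff.1 (h.low i hi) _

/-- No summand isomorphic to `ω` is common to `Y` and `X` via `π`. -/
def NoOmega (ω : Ideal R) (π : Y →ₗ[R] X) : Prop :=
  ∀ (u : ω →ₗ[R] Y) (p : X →ₗ[R] ω), ¬ Function.Bijective (p ∘ₗ π ∘ₗ u)

lemma NoOmega.bijective_id_sub (h : CanonIdeal R d ω) [Module.Finite R X] [Module.Finite R Y]
    (hX : Deep R d X) (hY : FID R Y) {π : Y →ₗ[R] X} (hπ : NoOmega ω π) (g : X →ₗ[R] Y) :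
    Function.Bijective (LinearMap.id - g ∘ₗ π : Y →ₗ[R] Y) := by
  obtain ⟨x, hxω, hx⟩ := h.regular
  obtain ⟨n, a, b, rfl⟩ := hX.exists_factor h.cm h.fid h.deep h.not_extV hxω hx hY g
  have hzero : ∀ i (z : EM R (ResidueField R) (Fin n → ω) i),
      extPost (ResidueField R) (a ∘ₗ π ∘ₗ b) i z = 0 := by
    intro i z
    obtain ⟨s, q, hid⟩ : ∃ (s : Fin n → ω →ₗ[R] (Fin n → ω)) (q : Fin n → (Fin n → ω) →ₗ[R] ω),
        LinearMap.id = ∑ j, s j ∘ₗ q j :=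
      ⟨LinearMap.single R _, LinearMap.proj, LinearMap.ext fun v => by
        simpa using (LinearMap.sum_single_apply (fun _ => ω) v).symm⟩
    rw [← extPost_id i (extPost _ _ i z), hid, extPost_sum]
    refine Finset.sum_eq_zero fun j _ => ?_
    rw [← extPost_id i z, hid, extPost_sum, map_sum, map_sum]
    refine Finset.sum_eq_zero fun k _ => ?_
    rw [extPost_comp (q j), extPost_comp (q k), ← extPost_comp _ (q j), ← extPost_comp (s k)]
    have := (h.bijective_or_ext_eq_zero ((q j ∘ₗ a) ∘ₗ π ∘ₗ (b ∘ₗ s k))).resolve_left (hπ _ _) i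
      (extPost _ (q k) i z)
    rw [show (q j ∘ₗ a ∘ₗ π ∘ₗ b) ∘ₗ s k = (q j ∘ₗ a) ∘ₗ π ∘ₗ (b ∘ₗ s k) from rfl, this, map_zero]
  refine OrzechProperty.bijective_of_surjective_endomorphism _
    (hY.surjective_of_ext h.cm fun i z => ?_)
  have hsq : extPost (ResidueField R) ((b ∘ₗ a) ∘ₗ π) i
      (extPost (ResidueField R) ((b ∘ₗ a) ∘ₗ π) i z) = 0 := by
    rw [← extPost_comp, show ((b ∘ₗ a) ∘ₗ π) ∘ₗ (b ∘ₗ a) ∘ₗ π =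
      b ∘ₗ (a ∘ₗ π ∘ₗ b) ∘ₗ (a ∘ₗ π) from rfl, extPost_comp, extPost_comp, hzero, map_zero]
  refine ⟨z + extPost _ ((b ∘ₗ a) ∘ₗ π) i z, ?_⟩
  rw [extPost_sub, extPost_id, map_add, hsq, add_zero, add_sub_cancel_right]

end Minimal

section Hull

open IsLocalRing (ResidueField)
open scoped TensorProduct

variable {R : Type} [CommRing R]
  {A B C M N Z Y X Y' X' W : Type} [AddCommGroup A] [Module R A] [AddCommGroup B] [Module R B]
  [AddCommGroup C] [Module R C] [AddCommGroup M] [Module R M] [AddCommGroup N] [Module R N]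
  [AddCommGroup Z] [Module R Z] [AddCommGroup Y] [Module R Y]
  [AddCommGroup X] [Module R X] [AddCommGroup Y'] [Module R Y'] [AddCommGroup X'] [Module R X']
  [AddCommGroup W] [Module R W]

lemma SES.desc {f : A →ₗ[R] B} {g : B →ₗ[R] C} (h : SES f g) (u : B →ₗ[R] N) (hu : u ∘ₗ f = 0) :
    ∃ v : C →ₗ[R] N, v ∘ₗ g = u := by
  have hle : LinearMap.ker g ≤ LinearMap.ker u := by
    intro b hb
    obtain ⟨a, rfl⟩ := (h.exact b).1 hb
    exact LinearMap.congr_fun hu a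
  refine ⟨(LinearMap.ker g).liftQ u hle ∘ₗ (g.quotKerEquivOfSurjective h.surj).symm, ?_⟩
  ext b
  have : (g.quotKerEquivOfSurjective h.surj).symm (g b) = (LinearMap.ker g).mkQ b := by
    rw [LinearEquiv.symm_apply_eq]
    rfl
  simp [this]

lemma SES.factor {f : A →ₗ[R] B} {g : B →ₗ[R] C} (h : SES f g) (u : N →ₗ[R] B)
    (hu : g ∘ₗ u = 0) : ∃ v : N →ₗ[R] A, f ∘ₗ v = u := by
  let e := LinearEquiv.ofInjective f h.inj
  refine ⟨e.symm ∘ₗ u.codRestrict (LinearMap.range f)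
    (fun n => (h.exact (u n)).1 (LinearMap.congr_fun hu n)), LinearMap.ext fun n => ?_⟩
  exact congrArg Subtype.val (e.apply_symm_apply _)

/-- A retraction splits off a direct summand. -/
lemma exists_split_equiv {s : W →ₗ[R] X} {p : X →ₗ[R] W} (hps : p ∘ₗ s = LinearMap.id) :
    ∃ e : X ≃ₗ[R] W × LinearMap.ker p, ∀ x, (e x).1 = p x ∧ ((e x).2 : X) = x - s (p x) := by
  have hps' : ∀ w, p (s w) = w := LinearMap.congr_fun hps
  let q : X →ₗ[R] LinearMap.ker p := (LinearMap.id - s ∘ₗ p).codRestrict _ fun x => by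
    simp [hps']
  have hq : ∀ x, (q x : X) = x - s (p x) := fun x => rfl
  refine ⟨LinearEquiv.ofLinearMap (p.prod q) (s.coprod (LinearMap.ker p).subtype) ?_ ?_,
    fun x => ⟨rfl, rfl⟩⟩
  · refine LinearMap.ext fun ⟨w, k, hk⟩ => Prod.ext ?_ (Subtype.ext ?_)
    · simpa [hps'] using hk
    · rw [LinearMap.mem_ker] at hk
      simp [hps', hq, hk]
  · ext x
    simp [hq]

variable [IsLocalRing R]

/-- A hull of `M` by modules of finite injective dimension. -/
structure IsHull (d : ℕ) (ι : M →ₗ[R] Y) (π : Y →ₗ[R] X) : Prop where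
  ses : SES ι π
  finite : Module.Finite R Y
  fid : FID R Y
  deep : Deep R d X

/-- The minimal number of generators. -/
def mu (R X : Type) [CommRing R] [IsLocalRing R] [AddCommGroup X] [Module R X] : ℕ :=
  Module.finrank (ResidueField R) (ResidueField R ⊗[R] X)

lemma mu_congr (e : X ≃ₗ[R] Y) : mu R X = mu R Y :=
  (e.baseChange R (ResidueField R) X Y).finrank_eq

lemma mu_prod [Module.Finite R X] [Module.Finite R Y] : mu R (X × Y) = mu R X + mu R Y := by
  rw [mu, (TensorProduct.prodRight R (ResidueField R) (ResidueField R) X Y).finrank_eq,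
    Module.finrank_prod, mu, mu]

lemma mu_pi [Module.Finite R X] (m : ℕ) : mu R (Fin m → X) = m * mu R X := by
  rw [mu, (TensorProduct.piRight R (ResidueField R) (ResidueField R)
    (fun _ : Fin m => X)).finrank_eq, Module.finrank_pi_fintype]
  simp [mu]

lemma mu_pos [Module.Finite R X] [Nontrivial X] : 0 < mu R X := by
  have : Nontrivial (ResidueField R ⊗[R] X) := by
    rw [← not_subsingleton_iff_nontrivial, IsLocalRing.subsingleton_tensorProduct,
      not_subsingleton_iff_nontrivial]
    infer_instance
  exact Module.finrank_pos

variable {d : ℕ} {ω : Ideal R}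

lemma IsHull.finite_right {ι : M →ₗ[R] Y} {π : Y →ₗ[R] X} (h : IsHull d ι π) :
    Module.Finite R X := by
  have := h.finite
  exact Module.Finite.of_surjective π h.ses.surj

lemma noOmega_of_not_hasCommonSummandVia (hω : CanonIdeal R d ω) {Y X : ModuleCat.{0} R}
    {π : Y →ₗ[R] X} (h : ¬ HasCommonSummandVia R π) : NoOmega ω π := by
  intro u p hb
  let e := LinearEquiv.ofBijective _ hb
  have hpu : p ∘ₗ π ∘ₗ (u ∘ₗ e.symm.toLinearMap) = LinearMap.id :=
    LinearMap.ext fun w => e.apply_symm_apply w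
  obtain ⟨g, hg⟩ := exists_split_equiv (s := u ∘ₗ e.symm.toLinearMap) (p := p ∘ₗ π) hpu
  obtain ⟨f, hf⟩ := exists_split_equiv (s := π ∘ₗ u ∘ₗ e.symm.toLinearMap) (p := p) hpu
  refine h ⟨ModuleCat.of R ω, ModuleCat.of R (LinearMap.ker (p ∘ₗ π)),
    ModuleCat.of R (LinearMap.ker p), hω.nontrivial, g, f,
    π.restrict (p := LinearMap.ker (p ∘ₗ π)) (q := LinearMap.ker p) fun _ hy => hy, fun y => ?_⟩
  refine Prod.ext ?_ (Subtype.ext ?_)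
  · exact (hf _).1.trans (hg y).1.symm
  · refine (hf _).2.trans ?_
    change _ = π (g y).2
    rw [(hg y).2, map_sub]
    rfl

variable [IsNoetherianRing R]

lemma IsHull.unique (hω : CanonIdeal R d ω) {ι : M →ₗ[R] Y} {π : Y →ₗ[R] X} (h : IsHull d ι π)
    (hπ : NoOmega ω π) {ι' : M →ₗ[R] Y'} {π' : Y' →ₗ[R] X'} (h' : IsHull d ι' π')
    (hπ' : NoOmega ω π') : Nonempty (X ≃ₗ[R] X') := by
  have := h.finite
  have := h'.finite
  have := h.finite_right
  have := h'.finite_right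
  obtain ⟨α, hα⟩ := h.ses.extend (h.deep.extV hω.cm h'.fid _ (by lia)) ι'
  obtain ⟨β, hβ⟩ := h'.ses.extend (h'.deep.extV hω.cm h.fid _ (by lia)) ι
  have hβα : Function.Bijective (β ∘ₗ α) := by
    obtain ⟨g, hg⟩ := h.ses.desc (LinearMap.id - β ∘ₗ α) (by
      rw [LinearMap.sub_comp, LinearMap.comp_assoc, hα, hβ, LinearMap.id_comp, sub_self])
    have := hπ.bijective_id_sub hω h.deep h.fid g
    rwa [hg, sub_sub_cancel] at this
  have hαβ : Function.Bijective (α ∘ₗ β) := by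
    obtain ⟨g, hg⟩ := h'.ses.desc (LinearMap.id - α ∘ₗ β) (by
      rw [LinearMap.sub_comp, LinearMap.comp_assoc, hβ, hα, LinearMap.id_comp, sub_self])
    have := hπ'.bijective_id_sub hω h'.deep h'.fid g
    rwa [hg, sub_sub_cancel] at this
  have hinj : Function.Injective α := Function.Injective.of_comp (f := β) hβα.injective
  have hsurj : Function.Surjective α := Function.Surjective.of_comp (g := β) hαβ.surjective
  obtain ⟨γ, hγ⟩ := h.ses.desc (π' ∘ₗ α) (by
    rw [LinearMap.comp_assoc, hα, h'.ses.comp_zero])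
  refine ⟨LinearEquiv.ofBijective γ ⟨?_, ?_⟩⟩
  · rw [← LinearMap.ker_eq_bot, LinearMap.ker_eq_bot']
    intro x hx
    obtain ⟨y, rfl⟩ := h.ses.surj x
    obtain ⟨m, hm⟩ := (h'.ses.exact (α y)).1 ((LinearMap.congr_fun hγ y).symm.trans hx)
    rw [← hα] at hm
    rw [← hinj hm, h.ses.apply_apply]
  · refine Function.Surjective.of_comp (g := π) ?_
    rw [← LinearMap.coe_comp, hγ]
    exact h'.ses.surj.comp hsurj

/-- Removing a common summand from a hull. -/
lemma IsHull.restrict {ι : M →ₗ[R] Y} {π : Y →ₗ[R] X} (h : IsHull d ι π) {u : W →ₗ[R] Y}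
    {p : X →ₗ[R] W} (hpu : p ∘ₗ π ∘ₗ u = LinearMap.id) :
    IsHull d (ι.codRestrict (LinearMap.ker (p ∘ₗ π)) fun m => by simp [h.ses.apply_apply])
      (π.restrict (p := LinearMap.ker (p ∘ₗ π)) (q := LinearMap.ker p) fun _ hy => hy) := by
  have hpu' : ∀ w, p (π (u w)) = w := LinearMap.congr_fun hpu
  have := h.finite
  obtain ⟨e, he⟩ := exists_split_equiv (s := u) (p := p ∘ₗ π) (by rw [← hpu]; rfl)
  obtain ⟨f, hf⟩ := exists_split_equiv (s := π ∘ₗ u) (p := p) hpu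
  refine ⟨⟨?_, ?_, ?_⟩, inferInstance, ?_, ?_⟩
  · exact fun a b hab => h.ses.inj (congrArg Subtype.val hab)
  · rintro ⟨x, hx⟩
    obtain ⟨y, rfl⟩ := h.ses.surj x
    exact ⟨⟨y, hx⟩, rfl⟩
  · rintro ⟨y, hy⟩
    constructor
    · intro hy0
      obtain ⟨m, hm⟩ := (h.ses.exact y).1 (congrArg Subtype.val hy0)
      exact ⟨m, Subtype.ext hm⟩
    · rintro ⟨m, hm⟩
      refine Subtype.ext ?_
      rw [← hm]
      exact h.ses.apply_apply m
  · exact h.fid.retract (Submodule.subtype _) (LinearMap.snd R _ _ ∘ₗ e.toLinearMap)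
      (LinearMap.ext fun y => Subtype.ext (by simp [(he _).2]))
  · refine h.deep.retract (Submodule.subtype _) (LinearMap.snd R _ _ ∘ₗ f.toLinearMap)
      (LinearMap.ext fun y => Subtype.ext ?_)
    have hy : p y = 0 := y.2
    simp [(hf _).2, hy]

/-- The largest power of `ω` that splits off from `π`. -/
lemma exists_noOmega (hω : CanonIdeal R d ω) [Module.Finite R X] (π : Y →ₗ[R] X) :
    ∃ (m : ℕ) (u : (Fin m → ω) →ₗ[R] Y) (p : X →ₗ[R] (Fin m → ω)),
      p ∘ₗ π ∘ₗ u = LinearMap.id ∧ NoOmega ω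
        (π.restrict (p := LinearMap.ker (p ∘ₗ π)) (q := LinearMap.ker p) fun _ hy => hy) := by
  have := hω.nontrivial
  by_contra! hno
  have H : ∀ m, ∃ (u : (Fin m → ω) →ₗ[R] Y) (p : X →ₗ[R] (Fin m → ω)),
      p ∘ₗ π ∘ₗ u = LinearMap.id := by
    intro m
    induction m with
    | zero => exact ⟨0, 0, LinearMap.ext fun _ => Subsingleton.elim _ _⟩
    | succ m ih =>
      obtain ⟨u, p, hpu⟩ := ih
      have hpu' : ∀ w, p (π (u w)) = w := LinearMap.congr_fun hpu
      have := hno m u p hpu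
      simp only [NoOmega, not_forall, not_not] at this
      obtain ⟨u₀, p₀, hb⟩ := this
      let e := LinearEquiv.ofBijective _ hb
      obtain ⟨f, hf⟩ := exists_split_equiv (s := π ∘ₗ u) (p := p) hpu
      let c := Fin.consLinearEquiv R (fun _ : Fin (m + 1) => ω)
      let u₁ : ω →ₗ[R] LinearMap.ker (p ∘ₗ π) := u₀ ∘ₗ e.symm.toLinearMap
      have hu₁ : ∀ w, p₀ ⟨π (u₁ w), (u₁ w).2⟩ = w := fun w => e.apply_symm_apply w
      refine ⟨((Submodule.subtype _ ∘ₗ u₁).coprod u) ∘ₗ c.symm.toLinearMap,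
        c.toLinearMap ∘ₗ (p₀ ∘ₗ LinearMap.snd R _ _ ∘ₗ f.toLinearMap).prod p,
        LinearMap.ext fun v => ?_⟩
      obtain ⟨⟨w, v⟩, rfl⟩ := c.surjective v
      have hw : p (π (u₁ w)) = 0 := (u₁ w).2
      have hx : (f (π (u₁ w + u v))).2 = ⟨π (u₁ w), hw⟩ :=
        Subtype.ext (by simp [(hf _).2, hw, hpu'])
      simp only [LinearMap.comp_apply, LinearEquiv.coe_coe, LinearEquiv.symm_apply_apply,
        LinearMap.coprod_apply, Submodule.subtype_apply, LinearMap.id_apply]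
      refine congrArg c (Prod.ext ?_ ?_)
      · change p₀ (f (π (u₁ w + u v))).2 = w
        rw [hx, hu₁]
      · change p (π (u₁ w + u v)) = v
        rw [map_add, map_add, hw, hpu', zero_add]
  obtain ⟨u, p, hpu⟩ := H (mu R X + 1)
  obtain ⟨f, -⟩ := exists_split_equiv (s := π ∘ₗ u) (p := p) hpu
  have h1 := mu_congr f
  rw [mu_prod, mu_pi] at h1
  have h2 : 0 < mu R ω := mu_pos
  nlinarith

lemma IsHull.compare (hω : CanonIdeal R d ω) {ι : M →ₗ[R] Y} {π : Y →ₗ[R] X} (h : IsHull d ι π)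
    (hπ : NoOmega ω π) {ι' : M →ₗ[R] Y'} {π' : Y' →ₗ[R] X'} (h' : IsHull d ι' π') :
    ∃ m, Nonempty (X' ≃ₗ[R] (Fin m → ω) × X) ∧
      ∃ (u : (Fin m → ω) →ₗ[R] Y') (p : X' →ₗ[R] (Fin m → ω)), p ∘ₗ π' ∘ₗ u = LinearMap.id := by
  have := h'.finite_right
  obtain ⟨m, u, p, hpu, hno⟩ := exists_noOmega hω π'
  obtain ⟨e⟩ := (h'.restrict hpu).unique hω hno h hπ
  obtain ⟨f, -⟩ := exists_split_equiv (s := π' ∘ₗ u) (p := p) hpu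
  exact ⟨m, ⟨f.trans ((LinearEquiv.refl R _).prodCongr e)⟩, u, p, hpu⟩

end Hull

section Comparison

open IsLocalRing (ResidueField)

variable {R : Type} [CommRing R]
  {A B C Q M Y X W : Type} [AddCommGroup A] [Module R A] [AddCommGroup B] [Module R B]
  [AddCommGroup C] [Module R C] [AddCommGroup Q] [Module R Q] [AddCommGroup M] [Module R M]
  [AddCommGroup Y] [Module R Y] [AddCommGroup X] [Module R X] [AddCommGroup W] [Module R W]

/-- The sequence `0 → Y → X ×_Q B → B → 0` attached to `0 → Y → X → Q → 0` and `B → Q`. -/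
lemma SES.pullback {ι : Y →ₗ[R] X} {π : X →ₗ[R] Q} (h : SES ι π) (q : B →ₗ[R] Q) :
    SES ((ι.prod (0 : Y →ₗ[R] B)).codRestrict
        (LinearMap.eqLocus (π ∘ₗ LinearMap.fst R X B) (q ∘ₗ LinearMap.snd R X B))
        fun y => by simp [h.apply_apply])
      (LinearMap.snd R X B ∘ₗ Submodule.subtype _) where
  inj a b hab := h.inj (congrArg (fun z => z.1.1) hab)
  surj b := by
    obtain ⟨x, hx⟩ := h.surj (q b)
    exact ⟨⟨(x, b), hx⟩, rfl⟩
  exact := by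
    rintro ⟨⟨x, b⟩, hxb⟩
    constructor
    · rintro (rfl : b = 0)
      obtain ⟨y, rfl⟩ := (h.exact x).1 (hxb.trans (map_zero q))
      exact ⟨y, rfl⟩
    · rintro ⟨y, hy⟩
      exact (congrArg (fun z => z.1.2) hy).symm

/-- The sequence `0 → A → X ×_Q B → X → 0` attached to `0 → A → B → Q → 0` and `X → Q`. -/
lemma SES.pullback' {j : A →ₗ[R] B} {q : B →ₗ[R] Q} (h : SES j q) (π : X →ₗ[R] Q) :
    SES (((0 : A →ₗ[R] X).prod j).codRestrict
        (LinearMap.eqLocus (π ∘ₗ LinearMap.fst R X B) (q ∘ₗ LinearMap.snd R X B))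
        fun y => by simp [h.apply_apply])
      (LinearMap.fst R X B ∘ₗ Submodule.subtype _) where
  inj a b hab := h.inj (congrArg (fun z => z.1.2) hab)
  surj x := by
    obtain ⟨b, hb⟩ := h.surj (π x)
    exact ⟨⟨(x, b), hb.symm⟩, rfl⟩
  exact := by
    rintro ⟨⟨x, b⟩, hxb⟩
    constructor
    · rintro (rfl : x = 0)
      obtain ⟨a, rfl⟩ := (h.exact b).1 ((map_zero π).symm.trans hxb).symm
      exact ⟨a, rfl⟩
    · rintro ⟨y, hy⟩
      exact (congrArg (fun z => z.1.1) hy).symm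

/-- The sequence `0 → B ⧸ A → Y ⧸ A → Y ⧸ B → 0`. -/
lemma SES.quotient {k : A →ₗ[R] B} {q : B →ₗ[R] C} (hk : SES k q) {ι : B →ₗ[R] Y}
    {π : Y →ₗ[R] X} (h : SES ι π) :
    ∃ (ι' : C →ₗ[R] Y ⧸ LinearMap.range (ι ∘ₗ k)) (π' : (Y ⧸ LinearMap.range (ι ∘ₗ k)) →ₗ[R] X),
      SES ι' π' := by
  have hs := SES.mkQ_range (f := ι ∘ₗ k) (h.inj.comp hk.inj)
  obtain ⟨ι', hι⟩ := hk.desc ((LinearMap.range (ι ∘ₗ k)).mkQ ∘ₗ ι) hs.comp_zero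
  obtain ⟨π', hπ⟩ := hs.desc π (by rw [← LinearMap.comp_assoc, h.comp_zero, LinearMap.zero_comp])
  have hι' : ∀ b, ι' (q b) = (LinearMap.range (ι ∘ₗ k)).mkQ (ι b) := LinearMap.congr_fun hι
  have hπ' : ∀ y, π' ((LinearMap.range (ι ∘ₗ k)).mkQ y) = π y := LinearMap.congr_fun hπ
  refine ⟨ι', π', ?_, ?_, ?_⟩
  · rw [← LinearMap.ker_eq_bot, LinearMap.ker_eq_bot']
    intro c hc
    obtain ⟨b, rfl⟩ := hk.surj c
    obtain ⟨a, ha⟩ := (hs.exact (ι b)).1 ((hι' b).symm.trans hc)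
    rw [← h.inj ha, hk.apply_apply]
  · intro x
    obtain ⟨y, rfl⟩ := h.surj x
    exact ⟨_, hπ' y⟩
  · intro z
    obtain ⟨y, rfl⟩ := hs.surj z
    rw [hπ']
    constructor
    · intro hy
      obtain ⟨b, rfl⟩ := (h.exact y).1 hy
      exact ⟨q b, hι' b⟩
    · rintro ⟨c, hc⟩
      obtain ⟨b, rfl⟩ := hk.surj c
      rw [hι'] at hc
      rw [← hπ', ← hc, hπ', h.apply_apply]

lemma SES.ideal {I J : Ideal R} (hJI : J ≤ I) :
    SES (Submodule.inclusion hJI) (Submodule.comap I.subtype J).mkQ where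
  inj := Submodule.inclusion_injective hJI
  surj := Submodule.mkQ_surjective _
  exact := by
    intro a
    rw [Submodule.mkQ_apply, Submodule.Quotient.mk_eq_zero]
    exact ⟨fun ha => ⟨⟨a, ha⟩, rfl⟩, fun ⟨b, hb⟩ => hb ▸ b.2⟩

lemma exists_ses_span_mul {x : R} (hx : x ∈ nonZeroDivisors R) {I J : Ideal R}
    (h : Ideal.span {x} * J ≤ I) :
    ∃ k : J →ₗ[R] I, SES k (Submodule.comap I.subtype (Ideal.span {x} * J)).mkQ := by
  let k : J →ₗ[R] I := (LinearMap.lsmul R R x ∘ₗ J.subtype).codRestrict I fun c =>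
    h (Ideal.mem_span_singleton_mul.2 ⟨c, c.2, rfl⟩)
  refine ⟨k, ?_, Submodule.mkQ_surjective _, ?_⟩
  · intro a b hab
    have : x * (a : R) = x * b := congrArg Subtype.val hab
    exact Subtype.ext ((mul_cancel_left_mem_nonZeroDivisors hx).1 this)
  · intro a
    rw [Submodule.mkQ_apply, Submodule.Quotient.mk_eq_zero, Submodule.mem_comap,
      Submodule.subtype_apply, Ideal.mem_span_singleton_mul]
    exact ⟨fun ⟨z, hz, hza⟩ => ⟨⟨z, hz⟩, Subtype.ext hza⟩,
      fun ⟨z, hz⟩ => ⟨z, z.2, congrArg Subtype.val hz⟩⟩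

lemma exists_ses_ideal_quotient {I J K : Ideal R} (hKJ : K ≤ J) (hJI : J ≤ I) :
    ∃ (j : (J ⧸ Submodule.comap J.subtype K) →ₗ[R] I ⧸ Submodule.comap I.subtype K)
      (q : (I ⧸ Submodule.comap I.subtype K) →ₗ[R] I ⧸ Submodule.comap I.subtype J), SES j q := by
  refine ⟨Submodule.mapQ _ _ (Submodule.inclusion hJI) fun _ h => h,
    Submodule.factor (Submodule.comap_mono hKJ), ?_, Submodule.factor_surjective _, ?_⟩
  · rw [← LinearMap.ker_eq_bot, LinearMap.ker_eq_bot']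
    intro a ha
    obtain ⟨a, rfl⟩ := Submodule.mkQ_surjective _ a
    exact (Submodule.Quotient.mk_eq_zero _).2 ((Submodule.Quotient.mk_eq_zero
      (Submodule.comap I.subtype K) (x := Submodule.inclusion hJI a)).1 ha)
  · intro a
    obtain ⟨a, rfl⟩ := Submodule.mkQ_surjective _ a
    constructor
    · intro ha
      have : (a : R) ∈ J :=
        (Submodule.Quotient.mk_eq_zero (Submodule.comap I.subtype J) (x := a)).1 ha
      exact ⟨Submodule.mkQ _ ⟨a, this⟩, rfl⟩
    · rintro ⟨b, hb⟩
      obtain ⟨b, rfl⟩ := Submodule.mkQ_surjective _ b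
      rw [← hb]
      exact (Submodule.Quotient.mk_eq_zero _).2 b.2

variable [IsLocalRing R] [IsNoetherianRing R] {d : ℕ} {ω : Ideal R}

/-- At most one copy of `ω` splits off from the projection `X ×_Q B → X`. -/
lemma CanonIdeal.le_one (hω : CanonIdeal R d ω) {ι : Y →ₗ[R] X} {π : X →ₗ[R] Q} (h : SES ι π)
    [Module.Finite R Y] (hY : FID R Y) (hι : NoOmega ω ι) {k : ω →ₗ[R] ω} {q : ω →ₗ[R] B}
    (hk : SES k q) (π' : B →ₗ[R] Q) {m : ℕ}
    (u : (Fin m → ω) →ₗ[R]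
      LinearMap.eqLocus (π ∘ₗ LinearMap.fst R X B) (π' ∘ₗ LinearMap.snd R X B))
    (p : X →ₗ[R] (Fin m → ω))
    (hpu : p ∘ₗ (LinearMap.fst R X B ∘ₗ Submodule.subtype _) ∘ₗ u = LinearMap.id) : m ≤ 1 := by
  obtain ⟨s, hs⟩ := h.lift (hω.deep.extV hω.cm hY _ (by lia)) (π' ∘ₗ q)
  have hs' : ∀ w, π (s w) = π' (q w) := LinearMap.congr_fun hs
  have hpu' : ∀ w, p (u w).1.1 = w := LinearMap.congr_fun hpu
  have hr : ∀ j : Fin m, ∃ r : ω →ₗ[R] ω, ∀ w, q (r w) = (u (Pi.single j w)).1.2 := by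
    intro j
    obtain ⟨r, hr⟩ := hk.lift (hω.deep.extV hω.cm hω.fid _ (by lia))
      (LinearMap.snd R X B ∘ₗ Submodule.subtype _ ∘ₗ u ∘ₗ LinearMap.single R (fun _ => ω) j)
    exact ⟨r, LinearMap.congr_fun hr⟩
  choose r hr using hr
  have hv : ∀ j : Fin m, ∃ v : ω →ₗ[R] Y, ∀ w, ι (v w) = (u (Pi.single j w)).1.1 - s (r j w) := by
    intro j
    obtain ⟨v, hv⟩ := h.factor ((LinearMap.fst R X B ∘ₗ Submodule.subtype _ ∘ₗ u ∘ₗ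
      LinearMap.single R (fun _ => ω) j) - s ∘ₗ r j) (LinearMap.ext fun w => by
        have := (u (Pi.single j w)).2
        rw [LinearMap.mem_eqLocus] at this
        change π ((u (Pi.single j w)).1.1 - s (r j w)) = 0
        rw [map_sub, hs', hr, sub_eq_zero]
        exact this)
    exact ⟨v, LinearMap.congr_fun hv⟩
  choose v hv using hv
  let c : Fin m → ω →ₗ[R] ω := fun i => LinearMap.proj i ∘ₗ p ∘ₗ s
  have hcr : ∀ i j, (LinearMap.proj i ∘ₗ p) ∘ₗ ι ∘ₗ v j =
      LinearMap.proj i ∘ₗ LinearMap.single R (fun _ => ω) j - c i ∘ₗ r j := by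
    intro i j
    refine LinearMap.ext fun w => ?_
    change p (ι (v j w)) i = (Pi.single j w : Fin m → ω) i - p (s (r j w)) i
    rw [hv, map_sub, hpu']
    rfl
  have hzero : ∀ i j z, extPost (ResidueField R) (LinearMap.proj i ∘ₗ
      LinearMap.single R (fun _ => ω) j) d z =
      extPost (ResidueField R) (c i) d (extPost (ResidueField R) (r j) d z) := by
    intro i j z
    have := (hω.bijective_or_ext_eq_zero _).resolve_left (hι (v j) (LinearMap.proj i ∘ₗ p)) d z
    rwa [hcr, extPost_sub, sub_eq_zero, extPost_comp (r j)] at this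
  by_contra! hm
  have := hω.simple
  have := IsSimpleModule.nontrivial R (EM R (ResidueField R) ω d)
  obtain ⟨z, hz⟩ := exists_ne (0 : EM R (ResidueField R) ω d)
  have hdiag : ∀ i z,
      extPost (ResidueField R) (c i) d (extPost (ResidueField R) (r i) d z) = z := by
    intro i z
    rw [← hzero, show LinearMap.proj i ∘ₗ LinearMap.single R (fun _ => ω) i = LinearMap.id from
      LinearMap.ext fun w => Pi.single_eq_same (M := fun _ => ω) i w, extPost_id]
  let a : Fin m := ⟨0, by lia⟩
  let b : Fin m := ⟨1, hm⟩
  have hab : a ≠ b := by simp [a, b]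
  have hoff : extPost (ResidueField R) (c a) d (extPost (ResidueField R) (r b) d z) = 0 := by
    rw [← hzero, show LinearMap.proj a ∘ₗ LinearMap.single R (fun _ => ω) b = 0 from
      LinearMap.ext fun w => Pi.single_eq_of_ne (M := fun _ => ω) hab w, extPost_zero]
  rcases LinearMap.bijective_or_eq_zero (extPost (ResidueField R) (c a) d) with hb | h0
  · have h1 := hb.injective (hoff.trans (map_zero _).symm)
    have h2 := hdiag b z
    rw [h1, map_zero] at h2
    exact hz h2.symm
  · have h2 := hdiag a z
    rw [h0] at h2
    exact hz h2.symm

/-- The modules `X_{ω/ω²}`, `X^{ω²/xω}` and `X^{ω²}` agree up to copies of `ω`. -/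
lemma CanonIdeal.exists_equiv (hω : CanonIdeal R d ω) {x : R} (hxω : x ∈ ω)
    (hx : x ∈ nonZeroDivisors R)
    {Y₁ X₁ Y₂ X₂ Y₃ X₃ : Type} [AddCommGroup Y₁] [Module R Y₁] [AddCommGroup X₁] [Module R X₁]
    [AddCommGroup Y₂] [Module R Y₂] [AddCommGroup X₂] [Module R X₂]
    [AddCommGroup Y₃] [Module R Y₃] [AddCommGroup X₃] [Module R X₃]
    {ι₁ : Y₁ →ₗ[R] X₁} {π₁ : X₁ →ₗ[R] ω ⧸ Submodule.comap ω.subtype (ω ^ 2)} (h₁ : SES ι₁ π₁)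
    [Module.Finite R Y₁] [Module.Finite R X₁] (hY₁ : FID R Y₁) (hX₁ : Deep R d X₁)
    (hι₁ : NoOmega ω ι₁)
    {ι₂ : (ω ^ 2 : Ideal R) ⧸ Submodule.comap (ω ^ 2).subtype (Ideal.span {x} * ω) →ₗ[R] Y₂}
    {π₂ : Y₂ →ₗ[R] X₂} (h₂ : IsHull d ι₂ π₂) (hπ₂ : NoOmega ω π₂)
    {ι₃ : (ω ^ 2 : Ideal R) →ₗ[R] Y₃} {π₃ : Y₃ →ₗ[R] X₃} (h₃ : IsHull d ι₃ π₃)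
    (hπ₃ : NoOmega ω π₃) :
    ∃ a b c, a ≤ 1 ∧ Nonempty (X₁ ≃ₗ[R] (Fin a → ω) × X₂) ∧
      Nonempty (X₁ ≃ₗ[R] (Fin b → ω) × X₃) ∧ Nonempty (X₃ ≃ₗ[R] (Fin c → ω) × X₂) := by
  have hle : ω ^ 2 ≤ ω := Ideal.pow_le_self two_ne_zero
  have hxle : Ideal.span {x} * ω ≤ ω ^ 2 := by
    rw [pow_two]
    exact Ideal.mul_mono_left ((Ideal.span_singleton_le_iff_mem _).2 hxω)
  obtain ⟨k, hk⟩ := exists_ses_span_mul hx (hxle.trans hle)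
  obtain ⟨k', hk'⟩ := exists_ses_span_mul hx hxle
  obtain ⟨j, q, hjq⟩ := exists_ses_ideal_quotient hxle hle
  obtain ⟨a, ea, u, p, hpu⟩ := h₂.compare hω hπ₂ (π' := LinearMap.fst R X₁ _ ∘ₗ Submodule.subtype _)
    ⟨hjq.pullback' π₁, inferInstance,
      (h₁.pullback q).fid_mid hY₁ (hk.fid_right hω.fid hω.fid), hX₁⟩
  obtain ⟨b, eb, -⟩ := h₃.compare hω hπ₃ (π' := LinearMap.fst R X₁ _ ∘ₗ Submodule.subtype _)
    ⟨(SES.ideal hle).pullback' π₁, inferInstance,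
      (h₁.pullback (Submodule.mkQ _)).fid_mid hY₁ hω.fid, hX₁⟩
  obtain ⟨ι, π, hs⟩ := hk'.quotient h₃.ses
  have := h₃.finite
  obtain ⟨c, ec, -⟩ := h₂.compare hω hπ₂ (π' := π)
    ⟨hs, inferInstance, (SES.mkQ_range (f := ι₃ ∘ₗ k') (h₃.ses.inj.comp hk'.inj)).fid_right
      hω.fid h₃.fid, h₃.deep⟩
  exact ⟨a, b, c, hω.le_one h₁ hY₁ hι₁ hk q u p hpu, ea, eb, ec⟩

end Comparison

section Conclusion

open IsLocalRing (ResidueField)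

variable {R : Type} [CommRing R]

lemma HasFiniteInjDim.to_fid {Y : ModuleCat.{0} R} (h : HasFiniteInjDim R Y) : FID R Y := by
  obtain ⟨n, hn⟩ := h
  exact ⟨n, fun N _ _ i hi => (modExt_subsingleton_iff i).1 (hn (ModuleCat.of R N) i hi)⟩

variable [IsLocalRing R] {d : ℕ}

lemma deep_of_moduleDepth {X : ModuleCat.{0} R} (hd : ringKrullDim R = d)
    (h : (moduleDepth R X : WithBot ℕ∞) = ringKrullDim R) :
    Deep R d X ∧ ¬ ExtV R (ResidueField R) X d := by
  have h' : moduleDepth R X = (d : ℕ∞) := by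
    rw [hd] at h
    exact_mod_cast h
  constructor
  · intro l hl
    rw [← modExt_subsingleton_iff (X := ModuleCat.of R (ResidueField R)) (Y := X) l]
    by_contra hn
    rw [not_subsingleton_iff_nontrivial] at hn
    have : moduleDepth R X ≤ l := sInf_le ⟨l, rfl, hn⟩
    rw [h', Nat.cast_le] at this
    lia
  · rw [← modExt_subsingleton_iff (X := ModuleCat.of R (ResidueField R)) (Y := X) d,
      not_subsingleton_iff_nontrivial]
    have hne : {n : ℕ∞ | ∃ m : ℕ, n = (m : ℕ∞) ∧
        Nontrivial (ModExt R m (ModuleCat.of R (ResidueField R)) X)}.Nonempty := by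
      by_contra hemp
      rw [Set.not_nonempty_iff_eq_empty] at hemp
      rw [moduleDepth, hemp, sInf_empty] at h'
      exact ENat.top_ne_natCast d h'
    obtain ⟨m, hm, hn⟩ := csInf_mem hne
    have : (d : ℕ∞) = m := h'.symm.trans hm
    rw [Nat.cast_inj] at this
    exact this ▸ hn

lemma IsFIDHull.isHull {M Y X : ModuleCat.{0} R} {ι : M →ₗ[R] Y} {π : Y →ₗ[R] X}
    (hd : ringKrullDim R = d) (h : IsFIDHull R M Y X ι π) : IsHull d ι π := by
  obtain ⟨-, hfin, hfid, hX, hinj, hsurj, hex⟩ := h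
  refine ⟨⟨hinj, hsurj, hex⟩, hfin, hfid.to_fid, ?_⟩
  rcases hX with hX | hX
  · exact (deep_of_moduleDepth hd hX.2).1
  · exact fun l _ => extV_of_subsingleton_right

lemma IsCanonicalIdeal.canonIdeal (hCM : IsCMLocalRing R) {ω : Ideal R}
    (hω : IsCanonicalIdeal R ω) {x : R} (hxω : x ∈ ω) (hx : x ∈ nonZeroDivisors R) :
    ∃ d : ℕ, ringKrullDim R = d ∧ CanonIdeal R d ω := by
  obtain ⟨-, hfid, d, hd, ⟨e⟩, hlow⟩ := hω
  obtain ⟨h1, h2⟩ := deep_of_moduleDepth hd hCM.2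
  refine ⟨d, hd, ⟨h1, h2, hd⟩, hfid.to_fid, fun i hi => (modExt_subsingleton_iff i).1 (hlow i hi),
    ?_, x, hxω, hx⟩
  exact IsSimpleModule.congr
    ((modExtEquiv (ModuleCat.of R (ResidueField R)) (ModuleCat.of R ω) d).symm.trans e)

lemma not_nonempty_equiv_prod [IsNoetherianRing R] {W X : Type} [AddCommGroup W] [Module R W]
    [AddCommGroup X] [Module R X] [Module.Finite R W] [Module.Finite R X] [Nontrivial W] :
    ¬ Nonempty (X ≃ₗ[R] W × X) := by
  rintro ⟨e⟩
  have h1 := mu_congr e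
  rw [mu_prod] at h1
  have h2 : 0 < mu R W := mu_pos
  lia

lemma trichotomy [IsNoetherianRing R] {W X₁ X₂ X₃ : Type} [AddCommGroup W] [Module R W]
    [AddCommGroup X₁] [Module R X₁] [AddCommGroup X₂] [Module R X₂] [AddCommGroup X₃] [Module R X₃]
    [Module.Finite R W] [Module.Finite R X₂] [Module.Finite R X₃] [Nontrivial W] {a b c : ℕ}
    (ha : a ≤ 1) (ea : X₁ ≃ₗ[R] (Fin a → W) × X₂) (eb : X₁ ≃ₗ[R] (Fin b → W) × X₃)
    (ec : X₃ ≃ₗ[R] (Fin c → W) × X₂) :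
    (Nonempty (X₁ ≃ₗ[R] X₂) ∧ Nonempty (X₂ ≃ₗ[R] X₃)) ∨
      (Nonempty (X₁ ≃ₗ[R] (W × X₂)) ∧ Nonempty ((W × X₂) ≃ₗ[R] X₃)) ∨
      (Nonempty (X₁ ≃ₗ[R] (W × X₂)) ∧ Nonempty ((W × X₂) ≃ₗ[R] (W × X₃))) := by
  have habc : a = b + c := by
    have h1 := mu_congr (ea.symm.trans eb)
    have h2 := mu_congr ec
    rw [mu_prod, mu_prod, mu_pi, mu_pi] at h1
    rw [mu_prod, mu_pi] at h2
    have h3 : 0 < mu R W := mu_pos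
    refine Nat.eq_of_mul_eq_mul_right h3 ?_
    rw [add_mul]
    lia
  have zero : ∀ {X : Type} [AddCommGroup X] [Module R X], Nonempty (((Fin 0 → W) × X) ≃ₗ[R] X) :=
    ⟨LinearEquiv.uniqueProd⟩
  have one : ∀ {X : Type} [AddCommGroup X] [Module R X],
      Nonempty (((Fin 1 → W) × X) ≃ₗ[R] W × X) :=
    ⟨(LinearEquiv.funUnique (Fin 1) R W).prodCongr (LinearEquiv.refl R _)⟩
  obtain ⟨z₂⟩ := zero (X := X₂)
  obtain ⟨o₂⟩ := one (X := X₂)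
  obtain ⟨o₃⟩ := one (X := X₃)
  obtain ⟨rfl, rfl, rfl⟩ | ⟨rfl, rfl, rfl⟩ | ⟨rfl, rfl, rfl⟩ : (a = 0 ∧ b = 0 ∧ c = 0) ∨
      (a = 1 ∧ b = 0 ∧ c = 1) ∨ (a = 1 ∧ b = 1 ∧ c = 0) := by lia
  · exact Or.inl ⟨⟨ea.trans z₂⟩, ⟨(ec.trans z₂).symm⟩⟩
  · exact Or.inr (Or.inl ⟨⟨ea.trans o₂⟩, ⟨(ec.trans o₂).symm⟩⟩)
  · exact Or.inr (Or.inr ⟨⟨ea.trans o₂⟩, ⟨((ea.trans o₂).symm.trans eb).trans o₃⟩⟩)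

end Conclusion

theorem stmt7 (R : Type) [CommRing R] [IsLocalRing R]
    (hCM : IsCMLocalRing R) (hGG : IsGenericallyGorenstein R)
    (ω : Ideal R) (hω : IsCanonicalIdeal R ω)
    (x : R) (hxω : x ∈ ω) (hxreg : x ∈ nonZeroDivisors R)
    (Y₁ X₁ : ModuleCat R) (ι₁ : Y₁ →ₗ[R] X₁) (π₁ : X₁ →ₗ[R] qmod R ω (ω ^ 2))
    (h₁ : IsMinMCMApprox R (qmod R ω (ω ^ 2)) Y₁ X₁ ι₁ π₁)
    (Y₂ X₂ : ModuleCat R) (ι₂ : (qmod R (ω ^ 2) (Ideal.span {x} * ω)) →ₗ[R] Y₂) (π₂ : Y₂ →ₗ[R] X₂)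
    (h₂ : IsMinFIDHull R (qmod R (ω ^ 2) (Ideal.span {x} * ω)) Y₂ X₂ ι₂ π₂)
    (Y₃ X₃ : ModuleCat R) (ι₃ : (ModuleCat.of R ↥(ω ^ 2)) →ₗ[R] Y₃) (π₃ : Y₃ →ₗ[R] X₃)
    (h₃ : IsMinFIDHull R (ModuleCat.of R ↥(ω ^ 2)) Y₃ X₃ ι₃ π₃) :
    ((Nonempty (X₁ ≃ₗ[R] X₂) ∧ Nonempty (X₂ ≃ₗ[R] X₃)) ∨ (Nonempty (X₁ ≃ₗ[R] (↥ω × X₂)) ∧ Nonempty ((↥ω × X₂) ≃ₗ[R] X₃)) ∨ (Nonempty (X₁ ≃ₗ[R] (↥ω × X₂)) ∧ Nonempty ((↥ω × X₂) ≃ₗ[R] (↥ω × X₃)))) ∧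
      ¬ ((Nonempty (X₁ ≃ₗ[R] X₂) ∧ Nonempty (X₂ ≃ₗ[R] X₃)) ∧ (Nonempty (X₁ ≃ₗ[R] (↥ω × X₂)) ∧ Nonempty ((↥ω × X₂) ≃ₗ[R] X₃))) ∧ ¬ ((Nonempty (X₁ ≃ₗ[R] X₂) ∧ Nonempty (X₂ ≃ₗ[R] X₃)) ∧ (Nonempty (X₁ ≃ₗ[R] (↥ω × X₂)) ∧ Nonempty ((↥ω × X₂) ≃ₗ[R] (↥ω × X₃)))) ∧ ¬ ((Nonempty (X₁ ≃ₗ[R] (↥ω × X₂)) ∧ Nonempty ((↥ω × X₂) ≃ₗ[R] X₃)) ∧ (Nonempty (X₁ ≃ₗ[R] (↥ω × X₂)) ∧ Nonempty ((↥ω × X₂) ≃ₗ[R] (↥ω × X₃)))) := by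
  have := hCM.1
  obtain ⟨d, hd, hc⟩ := hω.canonIdeal hCM hxω hxreg
  have := hc.nontrivial
  obtain ⟨⟨-, hfinY₁, hX₁, hY₁, hinj, hsurj, hex⟩, hmin₁⟩ := h₁
  have := hX₁.1
  have H₂ := h₂.1.isHull hd
  have H₃ := h₃.1.isHull hd
  have := H₂.finite
  have := H₃.finite
  have := H₂.finite_right
  have := H₃.finite_right
  obtain ⟨a, b, c, ha, ⟨ea⟩, ⟨eb⟩, ⟨ec⟩⟩ := hc.exists_equiv hxω hxreg ⟨hinj, hsurj, hex⟩ hY₁.to_fid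
    (deep_of_moduleDepth hd hX₁.2).1 (noOmega_of_not_hasCommonSummandVia hc hmin₁)
    H₂ (noOmega_of_not_hasCommonSummandVia hc h₂.2) H₃ (noOmega_of_not_hasCommonSummandVia hc h₃.2)
  refine ⟨trichotomy ha ea eb ec, ?_, ?_, ?_⟩
  · rintro ⟨⟨⟨e⟩, -⟩, ⟨⟨f⟩, -⟩⟩
    exact not_nonempty_equiv_prod ⟨e.symm.trans f⟩
  · rintro ⟨⟨⟨e⟩, -⟩, ⟨⟨f⟩, -⟩⟩
    exact not_nonempty_equiv_prod ⟨e.symm.trans f⟩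
  · rintro ⟨⟨-, ⟨e⟩⟩, ⟨-, ⟨f⟩⟩⟩
    exact not_nonempty_equiv_prod ⟨e.symm.trans f⟩

end
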